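/- arXiv:2605.21881 — 5 statements merged into one kernel-verified Lean document; each statement's English description precedes it below -/
import Mathlib

section
/- Let u be a self-similar state function, i.e. u ∈ L^∞(ℍ; ℝ^n) with essential image contained in U_SH and u(x,t) = v(x/t) for a.e. (x,t) ∈ ℍ, where v is the associated reduced state function. Then u is a weak solution of u_t + f(u)_x = 0, meaning ∫₀^∞ ∫_ℝ [φ_t(x,t)·u(x,t) + φ_x(x,t)·f(u(x,t))] dx dt = 0 for all φ ∈ C¹_c(ℍ; ℝ^n), if and only if ∫_ℝ [ψ'(ξ)·(−ξ v(ξ) + f(v(ξ))) − ψ(ξ)·v(ξ)] dξ = 0 for all ψ ∈ C¹_c(ℝ; ℝ^n). -/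
open MeasureTheory Set Matrix

noncomputable section

/-- The essential image of `h` restricted to `Y`: the set of `z` every neighborhood of
which has preimage of positive measure inside `Y`. -/
def essimOn {α : Type*} [MeasureSpace α] {n : ℕ}
    (h : α → (Fin n → ℝ)) (Y : Set α) : Set (Fin n → ℝ) :=
  {z | ∀ V : Set (Fin n → ℝ), IsOpen V → z ∈ V → 0 < volume (h ⁻¹' V ∩ Y)}

/-- Left ess-im accumulation set of `v` at `ξ`. -/
def AessL {n : ℕ} (v : ℝ → (Fin n → ℝ)) (ξ : ℝ) : Set (Fin n → ℝ) :=
  ⋂ r > (0:ℝ), essimOn v (Set.Ioo (ξ - r) ξ)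

/-- Right ess-im accumulation set of `v` at `ξ`. -/
def AessR {n : ℕ} (v : ℝ → (Fin n → ℝ)) (ξ : ℝ) : Set (Fin n → ℝ) :=
  ⋂ r > (0:ℝ), essimOn v (Set.Ioo ξ (ξ + r))

/-- Two-sided ess-im accumulation set of `v` at `ξ`. -/
def Aess {n : ℕ} (v : ℝ → (Fin n → ℝ)) (ξ : ℝ) : Set (Fin n → ℝ) :=
  ⋂ r > (0:ℝ), essimOn v (Set.Ioo (ξ - r) (ξ + r))

/-- `ξ` is an ess-im continuity point of `v`. -/
def EssImContPt {n : ℕ} (v : ℝ → (Fin n → ℝ)) (ξ : ℝ) : Prop :=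
  ∃ z : Fin n → ℝ, AessL v ξ = {z} ∧ AessR v ξ = {z}

/-- Strictly hyperbolic region: states `u ∈ U` where `A(u) = Df(u)` has `n` distinct
real eigenvalues. -/
def USH {n : ℕ} (f : (Fin n → ℝ) → (Fin n → ℝ)) (U : Set (Fin n → ℝ)) :
    Set (Fin n → ℝ) :=
  {u | u ∈ U ∧ ∃ lam : Fin n → ℝ, Function.Injective lam ∧
    ∀ i, Module.End.HasEigenvalue
      ((fderiv ℝ f u).toLinearMap : Module.End ℝ (Fin n → ℝ)) (lam i)}

/-- A reduced state function: essentially bounded measurable `v : ℝ → ℝⁿ` with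
essential image contained in the strictly hyperbolic region. -/
def IsReducedState {n : ℕ} (f : (Fin n → ℝ) → (Fin n → ℝ)) (U : Set (Fin n → ℝ))
    (v : ℝ → (Fin n → ℝ)) : Prop :=
  Measurable v ∧ (∃ C : ℝ, ∀ᵐ ξ : ℝ ∂volume, ‖v ξ‖ ≤ C) ∧
    essimOn v Set.univ ⊆ USH f U

/-- `v` is a self-similar weak solution of `u_t + f(u)_x = 0`. -/
def IsSSWeakSol {n : ℕ} (f : (Fin n → ℝ) → (Fin n → ℝ)) (v : ℝ → (Fin n → ℝ)) : Prop :=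
  ∀ ψ : ℝ → (Fin n → ℝ), ContDiff ℝ 1 ψ → HasCompactSupport ψ →
    ∫ ξ : ℝ, ((deriv ψ ξ) ⬝ᵥ ((-ξ) • v ξ + f (v ξ)) - (ψ ξ) ⬝ᵥ (v ξ)) = 0

/-- `det (−ξ I + Df(u))`. -/
def detShift {n : ℕ} (f : (Fin n → ℝ) → (Fin n → ℝ)) (ξ : ℝ) (u : Fin n → ℝ) : ℝ :=
  LinearMap.det (-(ξ • (LinearMap.id : (Fin n → ℝ) →ₗ[ℝ] (Fin n → ℝ)))
    + (fderiv ℝ f u).toLinearMap)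

/-- The averaged matrix `M(u⁻, ξ, u⁺) = −ξ I + ∫₀¹ Df((1−τ)u⁻ + τu⁺) dτ`. -/
def Mmat {n : ℕ} (f : (Fin n → ℝ) → (Fin n → ℝ)) (um : Fin n → ℝ) (ξ : ℝ)
    (up : Fin n → ℝ) : (Fin n → ℝ) →L[ℝ] (Fin n → ℝ) :=
  -(ξ • (1 : (Fin n → ℝ) →L[ℝ] (Fin n → ℝ))) +
    ∫ τ in (0:ℝ)..(1:ℝ), fderiv ℝ f ((1 - τ) • um + τ • up)



lemma ss_slice {E : Type*} [NormedAddCommGroup E] [NormedSpace ℝ E]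
    {Φ : ℝ × ℝ → E} (hc : HasCompactSupport Φ) (ξ : ℝ) :
    HasCompactSupport (fun t => Φ (ξ, t)) := by
  refine HasCompactSupport.intro (hc.image continuous_snd) (fun t ht => ?_)
  by_contra h
  exact ht ⟨(ξ, t), subset_tsupport _ h, rfl⟩

lemma ss_cont {E : Type*} [NormedAddCommGroup E] [NormedSpace ℝ E]
    {Φ : ℝ × ℝ → E} (h : Continuous Φ) (hc : HasCompactSupport Φ) :
    Continuous (fun ξ => ∫ t, Φ (ξ, t)) := by
  have hk : IsCompact (Prod.snd '' tsupport Φ) := hc.image continuous_snd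
  have := continuous_parametric_integral_of_continuous (μ := (volume : Measure ℝ))
    (f := fun ξ t => Φ (ξ, t)) (by simpa [Function.uncurry_def] using h) hk
  convert this using 2 with ξ
  rw [setIntegral_eq_integral_of_forall_compl_eq_zero]
  intro t ht
  by_contra h
  exact ht ⟨(ξ, t), subset_tsupport _ h, rfl⟩

lemma ss_param {E : Type*} [NormedAddCommGroup E] [NormedSpace ℝ E]
    {Φ : ℝ × ℝ → E} (h : ContDiff ℝ 1 Φ) (hc : HasCompactSupport Φ) (ξ : ℝ) :
    HasDerivAt (fun ξ => ∫ t, Φ (ξ, t)) (∫ t, fderiv ℝ Φ (ξ, t) (1, 0)) ξ := by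
  have hk : IsCompact (Prod.snd '' tsupport Φ) := hc.image continuous_snd
  have hc' : HasCompactSupport (fun q => fderiv ℝ Φ q (1, 0)) := hc.fderiv_apply ℝ _
  have hd' : Continuous (fun q => fderiv ℝ Φ q (1, 0)) :=
    (h.continuous_fderiv one_ne_zero).clm_apply continuous_const
  obtain ⟨C, hC⟩ := hc'.exists_bound_of_continuous hd'
  refine (hasDerivAt_integral_of_dominated_loc_of_deriv_le (μ := (volume : Measure ℝ))
    (F := fun ξ t => Φ (ξ, t)) (F' := fun ξ t => fderiv ℝ Φ (ξ, t) (1, 0))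
    (bound := (Prod.snd '' tsupport Φ).indicator (fun _ => C)) (s := univ)
    Filter.univ_mem ?_ ?_ ?_ ?_ ?_ ?_).2
  · refine Filter.Eventually.of_forall fun x => ?_
    exact (h.continuous.comp (by fun_prop : Continuous fun t : ℝ => (x, t))).aestronglyMeasurable
  · exact (h.continuous.comp (by fun_prop : Continuous fun t : ℝ => (ξ, t))).integrable_of_hasCompactSupport
      (ss_slice hc ξ)
  · exact (hd'.comp (by fun_prop : Continuous fun t : ℝ => (ξ, t))).aestronglyMeasurable
  · refine Filter.Eventually.of_forall fun t x _ => ?_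
    by_cases ht : t ∈ Prod.snd '' tsupport Φ
    · rw [indicator_of_mem ht]; exact hC _
    · rw [indicator_of_notMem ht]
      have : fderiv ℝ Φ (x, t) = 0 := by
        by_contra hne
        exact ht ⟨(x, t), support_fderiv_subset ℝ hne, rfl⟩
      simp [this]
  · exact (integrable_indicator_iff hk.measurableSet).2 (integrableOn_const hk.measure_lt_top.ne)
  · refine Filter.Eventually.of_forall fun t x _ => ?_
    have h1 : HasFDerivAt Φ (fderiv ℝ Φ (x, t)) (x, t) :=
      (h.differentiable one_ne_zero _).hasFDerivAt
    exact h1.comp_hasDerivAt x ((hasDerivAt_id x).prodMk (hasDerivAt_const x t))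

lemma ss_param_contDiff {E : Type*} [NormedAddCommGroup E] [NormedSpace ℝ E]
    {Φ : ℝ × ℝ → E} (h : ContDiff ℝ 1 Φ) (hc : HasCompactSupport Φ) :
    ContDiff ℝ 1 (fun ξ => ∫ t, Φ (ξ, t)) := by
  rw [contDiff_one_iff_deriv]
  refine ⟨fun ξ => (ss_param h hc ξ).differentiableAt, ?_⟩
  have : deriv (fun ξ => ∫ t, Φ (ξ, t)) = fun ξ => ∫ t, fderiv ℝ Φ (ξ, t) (1, 0) :=
    funext fun ξ => (ss_param h hc ξ).deriv
  rw [this]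
  exact ss_cont (Φ := fun q => fderiv ℝ Φ q (1, 0))
    ((h.continuous_fderiv one_ne_zero).clm_apply continuous_const) (hc.fderiv_apply ℝ _)

lemma ss_param_supp {E : Type*} [NormedAddCommGroup E] [NormedSpace ℝ E]
    {Φ : ℝ × ℝ → E} (hc : HasCompactSupport Φ) :
    HasCompactSupport (fun ξ => ∫ t, Φ (ξ, t)) := by
  refine HasCompactSupport.intro (hc.image continuous_fst) (fun x hx => ?_)
  have : ∀ t, Φ (x, t) = 0 := fun t => by
    by_contra h
    exact hx ⟨(x, t), subset_tsupport _ h, rfl⟩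
  simp [this]

lemma ss_parts {E : Type*} [NormedAddCommGroup E] [NormedSpace ℝ E] [CompleteSpace E]
    {Φ : ℝ × ℝ → E} (h : ContDiff ℝ 1 Φ) (hc : HasCompactSupport Φ) (ξ : ℝ) :
    ∫ t, t • fderiv ℝ Φ (ξ, t) (0, 1) = - ∫ t, Φ (ξ, t) := by
  have hl : Continuous fun t : ℝ => (ξ, t) := by fun_prop
  have i0 : Integrable (fun t => Φ (ξ, t)) :=
    (h.continuous.comp hl).integrable_of_hasCompactSupport (ss_slice hc ξ)
  have i1 : Integrable (fun t => t • fderiv ℝ Φ (ξ, t) (0, 1)) := by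
    refine (continuous_id.smul (((h.continuous_fderiv one_ne_zero).clm_apply
      continuous_const).comp hl)).integrable_of_hasCompactSupport ?_
    exact HasCompactSupport.smul_left
      (ss_slice (Φ := fun q => fderiv ℝ Φ q (0, 1)) (hc.fderiv_apply ℝ _) ξ)
  have i2 : Integrable (fun t => t • Φ (ξ, t)) :=
    (continuous_id.smul (h.continuous.comp hl)).integrable_of_hasCompactSupport
      (HasCompactSupport.smul_left (ss_slice hc ξ))
  have key := integral_eq_zero_of_hasDerivAt_of_integrable (f := fun t => t • Φ (ξ, t))
    (f' := fun t => t • fderiv ℝ Φ (ξ, t) (0, 1) + Φ (ξ, t)) (fun t => by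
      have h1 : HasFDerivAt Φ (fderiv ℝ Φ (ξ, t)) (ξ, t) :=
        (h.differentiable one_ne_zero _).hasFDerivAt
      have h2 := h1.comp_hasDerivAt t ((hasDerivAt_const t ξ).prodMk (hasDerivAt_id t))
      have h3 := (hasDerivAt_id t).smul h2
      simp only [id_eq, one_smul, Function.comp_apply] at h3
      exact h3) (i1.add i0) i2
  rw [integral_add i1 i0] at key
  exact eq_neg_of_add_eq_zero_left key

lemma ss_cov (F : ℝ × ℝ → ℝ) :
    ∫ q in {q : ℝ × ℝ | 0 < q.2}, F q
      = ∫ q in {q : ℝ × ℝ | 0 < q.2}, q.2 * F (q.2 * q.1, q.2) := by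
  have hm : MeasurableSet {q : ℝ × ℝ | 0 < q.2} := (isOpen_lt continuous_const continuous_snd).measurableSet
  let T : ℝ × ℝ → ℝ × ℝ := fun q => (q.2 * q.1, q.2)
  let T' : ℝ × ℝ → (ℝ × ℝ →L[ℝ] ℝ × ℝ) := fun q =>
    (Matrix.toLin (.finTwoProd ℝ) (.finTwoProd ℝ)
    !![q.2, q.1; 0, 1]).toContinuousLinearMap
  have hT' : ∀ q, HasFDerivAt T (T' q) q := by
    intro q
    simp only [T, T']
    rw [Matrix.toLin_finTwoProd_toContinuousLinearMap]
    convert! HasFDerivAt.prodMk (𝕜 := ℝ) ((hasFDerivAt_snd (𝕜 := ℝ) (p := q)).mul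
      (hasFDerivAt_fst (𝕜 := ℝ) (p := q))) (hasFDerivAt_snd (𝕜 := ℝ) (p := q)) using 2
    simp
  have hdet : ∀ q, (T' q).det = q.2 := by
    intro q
    simp [T', LinearMap.det_toContinuousLinearMap, LinearMap.det_toLin]
  have himg : T '' {q : ℝ × ℝ | 0 < q.2} = {q : ℝ × ℝ | 0 < q.2} := by
    ext ⟨x, t⟩
    constructor
    · rintro ⟨⟨y, s⟩, hs, he⟩
      simp only [T, Prod.mk.injEq] at he
      simp only [mem_ofPred_eq] at hs ⊢
      rw [← he.2]; exact hs
    · intro ht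
      have ht : 0 < t := ht
      refine ⟨(x / t, t), ht, ?_⟩
      simp only [T]
      congr 1
      field_simp
  have hinj : InjOn T {q : ℝ × ℝ | 0 < q.2} := by
    rintro ⟨x, t⟩ ht ⟨y, s⟩ hs he
    have ht : 0 < t := ht
    simp only [T, Prod.mk.injEq] at he
    obtain ⟨h1, rfl⟩ := he
    rw [mul_left_cancel₀ ht.ne' h1]
  have := integral_image_eq_integral_abs_det_fderiv_smul volume hm
    (fun q _ => (hT' q).hasFDerivWithinAt) hinj F
  rw [himg] at this
  rw [this]
  refine setIntegral_congr_fun hm fun q hq => ?_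
  simp only [hdet, smul_eq_mul, T]
  rw [abs_of_pos hq]

lemma ss_integrable {n : ℕ} {a : ℝ × ℝ → Fin n → ℝ} (ha : Continuous a)
    (hac : HasCompactSupport a) {w : ℝ → Fin n → ℝ} (hw : AEStronglyMeasurable w volume)
    {C : ℝ} (hC : ∀ᵐ ξ, ‖w ξ‖ ≤ C) :
    Integrable (fun q : ℝ × ℝ => a q ⬝ᵥ w q.1) (volume.prod volume) := by
  simp only [dotProduct]
  refine integrable_finsetSum _ fun i _ => ?_
  have h1 : Integrable (fun q => a q i) (volume.prod volume) :=
    (ha.integrable_of_hasCompactSupport hac).eval i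
  have h2 : AEStronglyMeasurable (fun q : ℝ × ℝ => w q.1) (volume.prod volume) :=
    hw.comp_quasiMeasurePreserving Measure.quasiMeasurePreserving_fst
  refine h1.mul_bdd (c := C) ?_ ?_
  · exact (continuous_apply i).comp_aestronglyMeasurable h2
  · have h3 : ∀ᵐ q : ℝ × ℝ ∂(volume.prod volume), ‖w q.1‖ ≤ C :=
      Measure.quasiMeasurePreserving_fst.ae hC
    filter_upwards [h3] with q hq
    exact (norm_le_pi_norm _ i).trans hq

lemma ss_dot {n : ℕ} {a : ℝ → Fin n → ℝ} (ha : Integrable a) (w : Fin n → ℝ) :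
    ∫ t, a t ⬝ᵥ w = (∫ t, a t) ⬝ᵥ w := by
  simp only [dotProduct]
  rw [integral_finsetSum _ fun i _ => (ha.eval i).mul_const _]
  refine Finset.sum_congr rfl fun i _ => ?_
  rw [integral_mul_const, eval_integral fun i => ha.eval i]

lemma ss_ident {n : ℕ} {Φ : ℝ × ℝ → Fin n → ℝ} (h : ContDiff ℝ 1 Φ) (hc : HasCompactSupport Φ)
    {w g : ℝ → Fin n → ℝ} (hw : AEStronglyMeasurable w volume)
    (hg : AEStronglyMeasurable g volume)
    {C D : ℝ} (hC : ∀ᵐ ξ, ‖w ξ‖ ≤ C) (hD : ∀ᵐ ξ, ‖g ξ‖ ≤ D) :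
    ∫ q : ℝ × ℝ, ((q.2 • fderiv ℝ Φ q (0, 1) - q.1 • fderiv ℝ Φ q (1, 0)) ⬝ᵥ w q.1
        + fderiv ℝ Φ q (1, 0) ⬝ᵥ g q.1)
      = ∫ ξ, (deriv (fun ξ => ∫ t, Φ (ξ, t)) ξ ⬝ᵥ ((-ξ) • w ξ + g ξ)
          - (∫ t, Φ (ξ, t)) ⬝ᵥ w ξ) := by
  have c1 : Continuous fun q => fderiv ℝ Φ q (1, 0) :=
    (h.continuous_fderiv one_ne_zero).clm_apply continuous_const
  have c2 : Continuous fun q => fderiv ℝ Φ q (0, 1) :=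
    (h.continuous_fderiv one_ne_zero).clm_apply continuous_const
  have s1 : HasCompactSupport fun q => fderiv ℝ Φ q (1, 0) := hc.fderiv_apply ℝ _
  have s2 : HasCompactSupport fun q => fderiv ℝ Φ q (0, 1) := hc.fderiv_apply ℝ _
  have c3 : Continuous fun q : ℝ × ℝ => q.2 • fderiv ℝ Φ q (0, 1) - q.1 • fderiv ℝ Φ q (1, 0) := by
    fun_prop
  have s3 : HasCompactSupport
      fun q : ℝ × ℝ => q.2 • fderiv ℝ Φ q (0, 1) - q.1 • fderiv ℝ Φ q (1, 0) :=
    (HasCompactSupport.smul_left (f := fun q : ℝ × ℝ => q.2) s2).sub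
      (HasCompactSupport.smul_left (f := fun q : ℝ × ℝ => q.1) s1)
  have hi := (ss_integrable c3 s3 hw hC).add (ss_integrable c1 s1 hg hD)
  rw [Measure.volume_eq_prod]
  refine (integral_prod _ hi).trans ?_
  simp only [Pi.add_apply]
  refine integral_congr_ae (Filter.Eventually.of_forall fun ξ => ?_)
  have hl : Continuous fun t : ℝ => (ξ, t) := by fun_prop
  have i1 : Integrable (fun t => fderiv ℝ Φ (ξ, t) (1, 0)) :=
    (c1.comp hl).integrable_of_hasCompactSupport (ss_slice s1 ξ)
  have i2 : Integrable (fun t => t • fderiv ℝ Φ (ξ, t) (0, 1)) :=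
    (continuous_id.smul (c2.comp hl)).integrable_of_hasCompactSupport
      (HasCompactSupport.smul_left (ss_slice s2 ξ))
  have i3 : Integrable (fun t => t • fderiv ℝ Φ (ξ, t) (0, 1) - ξ • fderiv ℝ Φ (ξ, t) (1, 0)) :=
    i2.sub (i1.smul ξ)
  have e : ∀ t : ℝ, (t • fderiv ℝ Φ (ξ, t) (0, 1) - ξ • fderiv ℝ Φ (ξ, t) (1, 0)) ⬝ᵥ w ξ
        + fderiv ℝ Φ (ξ, t) (1, 0) ⬝ᵥ g ξ
      = (t • fderiv ℝ Φ (ξ, t) (0, 1)) ⬝ᵥ w ξ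
        + fderiv ℝ Φ (ξ, t) (1, 0) ⬝ᵥ ((-ξ) • w ξ + g ξ) := by
    intro t
    simp only [sub_dotProduct, smul_dotProduct, dotProduct_add, dotProduct_smul, smul_eq_mul]
    ring
  have j : ∀ {a : ℝ → Fin n → ℝ} (_ : Integrable a) (z : Fin n → ℝ),
      Integrable fun t => a t ⬝ᵥ z := by
    intro a ha z
    simp only [dotProduct]
    exact integrable_finsetSum _ fun i _ => (ha.eval i).mul_const _
  simp only [e]
  rw [integral_add (j i2 _) (j i1 _), ss_dot i2, ss_dot i1, ss_parts h hc, (ss_param h hc ξ).deriv,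
    neg_dotProduct]
  ring

/-- The essential image of a bounded measurable function is compact and contains almost
every value. -/
lemma ss_essim {n : ℕ} {v : ℝ → Fin n → ℝ} (hv : Measurable v) {C : ℝ}
    (hC : ∀ᵐ ξ, ‖v ξ‖ ≤ C) :
    IsCompact (essimOn v univ) ∧ ∀ᵐ ξ, v ξ ∈ essimOn v univ := by
  have hout : ∀ z, z ∉ essimOn v univ → ∃ V, IsOpen V ∧ z ∈ V ∧ volume (v ⁻¹' V) = 0 := by
    intro z hz
    simp only [essimOn, mem_ofPred_eq, not_forall, inter_univ, not_lt, nonpos_iff_eq_zero] at hz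
    obtain ⟨V, h1, h2, h3⟩ := hz
    exact ⟨V, h1, h2, h3⟩
  constructor
  · refine Metric.isCompact_of_isClosed_isBounded ?_ ?_
    · rw [← isOpen_compl_iff, isOpen_iff_mem_nhds]
      intro z hz
      obtain ⟨V, h1, h2, h3⟩ := hout z hz
      refine Filter.mem_of_superset (h1.mem_nhds h2) fun y hy hy' => ?_
      have := hy' V h1 hy
      simp [h3] at this
    · refine (Metric.isBounded_closedBall (x := (0 : Fin n → ℝ)) (r := C)).subset fun z hz => ?_
      rw [mem_closedBall_zero_iff]
      by_contra! hlt
      have := hz {y | C < ‖y‖} (isOpen_lt continuous_const continuous_norm) hlt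
      refine this.ne' ?_
      rw [inter_univ]
      have h0 := ae_iff.1 hC
      simp only [not_le] at h0
      exact h0
  · have : (volume.map v) (essimOn v univ)ᶜ = 0 := by
      refine measure_null_of_locally_null _ fun z hz => ?_
      obtain ⟨V, h1, h2, h3⟩ := hout z hz
      exact ⟨V, mem_nhdsWithin_of_mem_nhds (h1.mem_nhds h2),
        by rwa [Measure.map_apply hv h1.measurableSet]⟩
    exact ae_of_ae_map hv.aemeasurable (p := fun z => z ∈ essimOn v univ) this

/-- A continuous flux composed with a reduced state is measurable and bounded. -/
lemma ss_flux {n : ℕ} {U : Set (Fin n → ℝ)} {f : (Fin n → ℝ) → (Fin n → ℝ)}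
    (hf : ContDiffOn ℝ 2 f U) {v : ℝ → (Fin n → ℝ)} (hv : IsReducedState f U v) :
    AEStronglyMeasurable (fun ξ => f (v ξ)) volume ∧ ∃ D : ℝ, ∀ᵐ ξ, ‖f (v ξ)‖ ≤ D := by
  obtain ⟨hm, ⟨C, hC⟩, hsub⟩ := hv
  obtain ⟨hK, hae⟩ := ss_essim hm hC
  have hcont : ContinuousOn f (essimOn v univ) :=
    hf.continuousOn.mono fun z hz => (hsub hz).1
  constructor
  · classical
    have hmeas : Measurable ((essimOn v univ).piecewise f (fun _ => 0)) :=
      hcont.measurable_piecewise continuousOn_const hK.measurableSet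
    refine ⟨_, (hmeas.comp hm).stronglyMeasurable, ?_⟩
    filter_upwards [hae] with ξ hξ
    simp [piecewise, hξ]
  · obtain ⟨D, hD⟩ := hK.exists_bound_of_continuousOn hcont
    exact ⟨D, hae.mono fun ξ hξ => hD _ hξ⟩

/-- The self-similar change of variables on test functions. -/
lemma ss_pull {n : ℕ} {φ : ℝ × ℝ → Fin n → ℝ} (hφ : ContDiff ℝ 1 φ) (hc : HasCompactSupport φ)
    (hs : tsupport φ ⊆ {q : ℝ × ℝ | 0 < q.2}) :
    HasCompactSupport (fun q : ℝ × ℝ => φ (q.2 * q.1, q.2)) := by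
  rcases (tsupport φ).eq_empty_or_nonempty with he | hne
  · have : φ = 0 := by
      rwa [tsupport_eq_empty_iff] at he
    subst this
    exact HasCompactSupport.zero
  obtain ⟨q0, hq0, hmin⟩ := hc.exists_isMinOn hne continuous_snd.continuousOn
  obtain ⟨M, hM⟩ := hc.exists_bound_of_continuousOn (f := fun q : ℝ × ℝ => q)
    continuousOn_id
  have ha : 0 < q0.2 := hs hq0
  refine HasCompactSupport.intro
    ((isCompact_Icc (a := -(M / q0.2)) (b := M / q0.2)).prod (isCompact_Icc (a := -M) (b := M))) ?_
  rintro ⟨ξ, t⟩ hq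
  by_contra hz
  have hmem : (t * ξ, t) ∈ tsupport φ := subset_tsupport _ hz
  have h1 : q0.2 ≤ t := hmin hmem
  have h2 := hM _ hmem
  rw [Prod.norm_def, max_le_iff] at h2
  obtain ⟨h3, h4⟩ := h2
  simp only [Real.norm_eq_abs] at h3 h4
  refine hq ⟨abs_le.1 ?_, abs_le.1 h4⟩
  rw [abs_mul, abs_of_pos (ha.trans_le h1)] at h3
  rw [le_div_iff₀ ha]
  have := mul_le_mul_of_nonneg_left h1 (abs_nonneg ξ)
  linarith

lemma ss_main {n : ℕ} {U : Set (Fin n → ℝ)} {f : (Fin n → ℝ) → (Fin n → ℝ)}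
    (hf : ContDiffOn ℝ 2 f U) {v : ℝ → (Fin n → ℝ)} (hv : IsReducedState f U v)
    {u : ℝ × ℝ → (Fin n → ℝ)}
    (hss : ∀ᵐ q : ℝ × ℝ ∂(volume.restrict {q : ℝ × ℝ | 0 < q.2}), u q = v (q.1 / q.2))
    {φ : ℝ × ℝ → Fin n → ℝ} (hφ : ContDiff ℝ 1 φ) (hc : HasCompactSupport φ)
    (hs : tsupport φ ⊆ {q : ℝ × ℝ | 0 < q.2}) :
    ∫ q in {q : ℝ × ℝ | 0 < q.2},
          ((fderiv ℝ φ q ((0:ℝ), (1:ℝ))) ⬝ᵥ u q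
            + (fderiv ℝ φ q ((1:ℝ), (0:ℝ))) ⬝ᵥ f (u q))
      = ∫ ξ, (deriv (fun ξ => ∫ t, φ (t * ξ, t)) ξ ⬝ᵥ ((-ξ) • v ξ + f (v ξ))
          - (∫ t, φ (t * ξ, t)) ⬝ᵥ v ξ) := by
  obtain ⟨hg, D, hD⟩ := ss_flux hf hv
  obtain ⟨hm, ⟨C, hC⟩, -⟩ := hv
  have hH : MeasurableSet {q : ℝ × ℝ | 0 < q.2} :=
    (isOpen_lt continuous_const continuous_snd).measurableSet
  have hΦ : ContDiff ℝ 1 (fun q : ℝ × ℝ => φ (q.2 * q.1, q.2)) :=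
    hφ.comp (by fun_prop : ContDiff ℝ 1 fun q : ℝ × ℝ => (q.2 * q.1, q.2))
  have hder : ∀ q : ℝ × ℝ, HasFDerivAt (fun q : ℝ × ℝ => φ (q.2 * q.1, q.2))
      ((fderiv ℝ φ (q.2 * q.1, q.2)).comp
        ((q.2 • ContinuousLinearMap.fst ℝ ℝ ℝ + q.1 • ContinuousLinearMap.snd ℝ ℝ ℝ).prod
          (ContinuousLinearMap.snd ℝ ℝ ℝ))) q := by
    intro q
    have h1 : HasFDerivAt φ (fderiv ℝ φ (q.2 * q.1, q.2)) (q.2 * q.1, q.2) :=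
      (hφ.differentiable one_ne_zero _).hasFDerivAt
    exact h1.comp q (HasFDerivAt.prodMk (𝕜 := ℝ) ((hasFDerivAt_snd (𝕜 := ℝ) (p := q)).mul
      (hasFDerivAt_fst (𝕜 := ℝ) (p := q))) (hasFDerivAt_snd (𝕜 := ℝ) (p := q)))
  have hlin : ∀ (L : ℝ × ℝ →L[ℝ] Fin n → ℝ) (a b : ℝ), L (a, b) = a • L (1, 0) + b • L (0, 1) := by
    intro L a b
    rw [← map_smul, ← map_smul, ← map_add]
    simp
  have d1 : ∀ q : ℝ × ℝ, fderiv ℝ (fun q : ℝ × ℝ => φ (q.2 * q.1, q.2)) q (1, 0)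
      = q.2 • fderiv ℝ φ (q.2 * q.1, q.2) (1, 0) := by
    intro q
    rw [(hder q).fderiv]
    simp only [ContinuousLinearMap.comp_apply, ContinuousLinearMap.prod_apply]
    rw [hlin]
    simp
  have d2 : ∀ q : ℝ × ℝ, fderiv ℝ (fun q : ℝ × ℝ => φ (q.2 * q.1, q.2)) q (0, 1)
      = q.1 • fderiv ℝ φ (q.2 * q.1, q.2) (1, 0) + fderiv ℝ φ (q.2 * q.1, q.2) (0, 1) := by
    intro q
    rw [(hder q).fderiv]
    simp only [ContinuousLinearMap.comp_apply, ContinuousLinearMap.prod_apply]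
    rw [hlin]
    simp
  have hid := ss_ident hΦ (ss_pull hφ hc hs) hm.aestronglyMeasurable hg hC hD
  simp only at hid
  rw [← hid]
  refine Eq.trans ?_ (setIntegral_eq_integral_of_forall_compl_eq_zero
    (s := {q : ℝ × ℝ | 0 < q.2}) ?_)
  · have e1 : ∫ q in {q : ℝ × ℝ | 0 < q.2},
          ((fderiv ℝ φ q ((0:ℝ), (1:ℝ))) ⬝ᵥ u q
            + (fderiv ℝ φ q ((1:ℝ), (0:ℝ))) ⬝ᵥ f (u q))
        = ∫ q in {q : ℝ × ℝ | 0 < q.2},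
          ((fderiv ℝ φ q ((0:ℝ), (1:ℝ))) ⬝ᵥ v (q.1 / q.2)
            + (fderiv ℝ φ q ((1:ℝ), (0:ℝ))) ⬝ᵥ f (v (q.1 / q.2))) := by
      refine integral_congr_ae ?_
      filter_upwards [hss] with q hq
      rw [hq]
    rw [e1, ss_cov]
    refine setIntegral_congr_fun hH fun q hq => ?_
    have hq : 0 < q.2 := hq
    simp only [d1, d2]
    rw [mul_div_cancel_left₀ _ hq.ne']
    simp only [sub_dotProduct, smul_dotProduct, add_dotProduct, smul_add, smul_eq_mul]
    ring
  · intro q hq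
    have : fderiv ℝ φ (q.2 * q.1, q.2) = 0 := by
      by_contra hne
      have hmem : (q.2 * q.1, q.2) ∈ tsupport φ := support_fderiv_subset ℝ hne
      have hpos : (q.2 * q.1, q.2) ∈ {p : ℝ × ℝ | 0 < p.2} := hs hmem
      exact hq hpos
    rw [d1, d2, this]
    simp

/-- Every reduced test function is the average of a test function on the half plane. -/
lemma ss_lift {n : ℕ} {ψ : ℝ → Fin n → ℝ} (hψ : ContDiff ℝ 1 ψ) (hc : HasCompactSupport ψ) :
    ∃ φ : ℝ × ℝ → Fin n → ℝ, ContDiff ℝ 1 φ ∧ HasCompactSupport φ ∧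
      tsupport φ ⊆ {q : ℝ × ℝ | 0 < q.2} ∧ ∀ ξ, ∫ t, φ (t * ξ, t) = ψ ξ := by
  let b : ContDiffBump (1 : ℝ) := ⟨1/4, 1/2, by norm_num, by norm_num⟩
  let χ : ℝ → ℝ := b.normed volume
  have hχ : ContDiff ℝ 1 χ := by
    have := b.contDiff_normed (μ := volume) (n := 1)
    exact_mod_cast this
  have hχs : ∀ t, t ∉ Icc (1/2 : ℝ) (3/2) → χ t = 0 := by
    intro t ht
    by_contra h
    have : t ∈ Function.support (b.normed volume) := h
    rw [b.support_normed_eq, Real.ball_eq_Ioo] at this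
    refine ht ⟨?_, ?_⟩
    · have := this.1; norm_num [b] at this; linarith
    · have := this.2; norm_num [b] at this; linarith
  obtain ⟨M, hM⟩ := hc.isCompact.exists_bound_of_continuousOn (f := fun x : ℝ => x) continuousOn_id
  have hzero : ∀ q : ℝ × ℝ,
      q ∉ Icc (-(2 * |M|)) (2 * |M|) ×ˢ Icc (1/2 : ℝ) (3/2) → χ q.2 • ψ (q.1 / q.2) = 0 := by
    rintro ⟨x, t⟩ hq
    by_cases ht : t ∈ Icc (1/2 : ℝ) (3/2)
    · have hx : x ∉ Icc (-(2 * |M|)) (2 * |M|) := fun h => hq ⟨h, ht⟩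
      have htp : 0 < t := by linarith [ht.1]
      have : ψ (x / t) = 0 := by
        by_contra hne
        have h1 := hM _ (subset_tsupport _ hne)
        rw [Real.norm_eq_abs, abs_div, abs_of_pos htp, div_le_iff₀ htp] at h1
        refine hx (abs_le.1 (h1.trans ?_))
        nlinarith [le_abs_self M, abs_nonneg M, ht.2]
      simp [this]
    · simp [hχs t ht]
  have hKc : IsCompact (Icc (-(2 * |M|)) (2 * |M|) ×ˢ Icc (1/2 : ℝ) (3/2)) :=
    isCompact_Icc.prod isCompact_Icc
  refine ⟨fun q => χ q.2 • ψ (q.1 / q.2), ?_, ?_, ?_, ?_⟩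
  · rw [contDiff_iff_contDiffAt]
    rintro ⟨x, t⟩
    by_cases ht : t = 0
    · have : (fun q : ℝ × ℝ => χ q.2 • ψ (q.1 / q.2)) =ᶠ[nhds (x, t)] fun _ => 0 := by
        have ho : IsOpen {q : ℝ × ℝ | q.2 < 1/2} := isOpen_lt continuous_snd continuous_const
        filter_upwards [ho.mem_nhds (by simp [ht] : (x, t) ∈ {q : ℝ × ℝ | q.2 < 1/2})] with q hq
        have hq : q.2 < 1/2 := hq
        rw [hχs q.2 fun h => by linarith [h.1], zero_smul]
      exact contDiffAt_const.congr_of_eventuallyEq this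
    · refine ContDiffAt.smul (hχ.contDiffAt.comp _ contDiffAt_snd) ?_
      exact hψ.contDiffAt.comp _ (contDiffAt_fst.div contDiffAt_snd ht)
  · exact HasCompactSupport.intro hKc hzero
  · refine (closure_minimal ?_ hKc.isClosed).trans fun q hq => ?_
    · intro q hq
      by_contra h
      exact hq (hzero q h)
    · have := hq.2.1
      show 0 < q.2
      linarith
  · intro ξ
    have e : ∀ t, χ t • ψ (t * ξ / t) = χ t • ψ ξ := by
      intro t
      by_cases ht : t = 0
      · rw [hχs t fun h => by linarith [h.1], zero_smul, zero_smul]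
      · rw [mul_div_cancel_left₀ _ ht]
    simp only [e]
    rw [integral_smul_const, b.integral_normed, one_smul]

/-- A self-similar state function `u(x,t) = v(x/t)` on the open upper
half-plane `ℍ = {(x,t) : t > 0}` is a weak solution of `u_t + f(u)_x = 0` iff the
reduced condition `∫ [ψ'·(−ξ v + f(v)) − ψ·v] dξ = 0` holds for all `ψ ∈ C¹_c`. -/
theorem weak_solution_iff_self_similar_weak_condition
    {n : ℕ} (U : Set (Fin n → ℝ)) (hU : IsOpen U)
    (f : (Fin n → ℝ) → (Fin n → ℝ)) (hf : ContDiffOn ℝ 2 f U)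
    (hconv : convexHull ℝ (USH f U) ⊆ U)
    (v : ℝ → (Fin n → ℝ)) (hv : IsReducedState f U v)
    (u : ℝ × ℝ → (Fin n → ℝ)) (humeas : Measurable u)
    (hubd : ∃ C : ℝ, ∀ᵐ q : ℝ × ℝ ∂(volume.restrict {q : ℝ × ℝ | 0 < q.2}), ‖u q‖ ≤ C)
    (hurange : essimOn u {q : ℝ × ℝ | 0 < q.2} ⊆ USH f U)
    (hss : ∀ᵐ q : ℝ × ℝ ∂(volume.restrict {q : ℝ × ℝ | 0 < q.2}), u q = v (q.1 / q.2)) :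
    (∀ φ : ℝ × ℝ → (Fin n → ℝ), ContDiff ℝ 1 φ → HasCompactSupport φ →
        tsupport φ ⊆ {q : ℝ × ℝ | 0 < q.2} →
        ∫ q in {q : ℝ × ℝ | 0 < q.2},
          ((fderiv ℝ φ q ((0:ℝ), (1:ℝ))) ⬝ᵥ u q
            + (fderiv ℝ φ q ((1:ℝ), (0:ℝ))) ⬝ᵥ f (u q)) = 0)
      ↔ IsSSWeakSol f v := by
  constructor
  · intro h ψ hψ hψc
    obtain ⟨φ, h1, h2, h3, h4⟩ := ss_lift hψ hψc
    have h5 := h φ h1 h2 h3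
    rw [ss_main hf hv hss h1 h2 h3] at h5
    simpa only [h4] using h5
  · intro h φ h1 h2 h3
    rw [ss_main hf hv hss h1 h2 h3]
    have hΦ : ContDiff ℝ 1 (fun q : ℝ × ℝ => φ (q.2 * q.1, q.2)) :=
      h1.comp (by fun_prop : ContDiff ℝ 1 fun q : ℝ × ℝ => (q.2 * q.1, q.2))
    have hΦc := ss_pull h1 h2 h3
    exact h _ (ss_param_contDiff hΦ hΦc) (ss_param_supp hΦc)

end
end

section
/- Let v ∈ L^∞(ℝ; ℝ^n) and let J ⊆ ℝ be an open interval such that every point of J is an ess-im continuity point of v, with ess-im accumulation value v̄(ξ) at each ξ ∈ J. Then the function v̄ : J → ℝ^n is continuous on J and v̄(ξ) = v(ξ) for a.e. ξ ∈ J. -/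
open MeasureTheory Set Matrix

noncomputable section

/-- Compactness: if the nested essential images meet only in `z`, then `v` is a.e. close to `z`
on small sets. -/
theorem aux_close {n : ℕ} (v : ℝ → (Fin n → ℝ)) (C : ℝ)
    (hC : ∀ᵐ ξ : ℝ ∂volume, ‖v ξ‖ ≤ C) (Y : ℝ → Set ℝ) (hY : Monotone Y)
    (z : Fin n → ℝ) (hz : (⋂ r > (0:ℝ), essimOn v (Y r)) = {z}) (ε : ℝ) (hε : 0 < ε) :
    ∃ r > (0:ℝ), ∀ᵐ x : ℝ ∂volume, x ∈ Y r → dist (v x) z < ε := by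
  have hK : IsCompact (Metric.closedBall (0 : Fin n → ℝ) C \ Metric.ball z ε) :=
    (isCompact_closedBall 0 C).diff Metric.isOpen_ball
  have key : ∃ r > (0:ℝ), volume (v ⁻¹' (Metric.closedBall (0 : Fin n → ℝ) C \
      Metric.ball z ε) ∩ Y r) = 0 := by
    refine hK.induction_on (p := fun s => ∃ r > (0:ℝ), volume (v ⁻¹' s ∩ Y r) = 0)
      ⟨1, one_pos, by simp⟩ ?_ ?_ ?_
    · rintro s t hst ⟨r, hr, h⟩
      exact ⟨r, hr, measure_mono_null (inter_subset_inter_left _ (preimage_mono hst)) h⟩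
    · rintro s t ⟨r, hr, h⟩ ⟨r', hr', h'⟩
      refine ⟨min r r', lt_min hr hr', measure_mono_null ?_ (measure_union_null h h')⟩
      rintro x ⟨hx | hx, hxY⟩
      · exact Or.inl ⟨hx, hY (min_le_left _ _) hxY⟩
      · exact Or.inr ⟨hx, hY (min_le_right _ _) hxY⟩
    · intro w hw
      have hwz : w ∉ (⋂ r > (0:ℝ), essimOn v (Y r)) := by
        rw [hz, mem_singleton_iff]
        rintro rfl
        exact hw.2 (Metric.mem_ball_self hε)
      simp only [mem_iInter, essimOn, mem_setOf_eq, not_forall, not_lt, nonpos_iff_eq_zero]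
        at hwz
      obtain ⟨r, hr, V, hV, hwV, h⟩ := hwz
      exact ⟨V, mem_nhdsWithin_of_mem_nhds (hV.mem_nhds hwV), r, hr, h⟩
  obtain ⟨r, hr, h⟩ := key
  refine ⟨r, hr, ?_⟩
  filter_upwards [hC, measure_eq_zero_iff_ae_notMem.1 h] with x hx hx2 hxY
  by_contra hcon
  exact hx2 ⟨⟨by simpa using hx, hcon⟩, hxY⟩

/-- If every point of an open interval `J` is an ess-im continuity
point of `v ∈ L^∞`, with accumulation value `vbar ξ` at each `ξ ∈ J`, then `vbar` is
continuous on `J` and equals `v` a.e. on `J`. -/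
theorem continuous_representative_on_essim_continuity_interval
    {n : ℕ} (v : ℝ → (Fin n → ℝ)) (hmeas : Measurable v)
    (hbd : ∃ C : ℝ, ∀ᵐ ξ : ℝ ∂volume, ‖v ξ‖ ≤ C)
    (J : Set ℝ) (hJopen : IsOpen J) (hJord : J.OrdConnected)
    (vbar : ℝ → (Fin n → ℝ))
    (hcont : ∀ ξ ∈ J, AessL v ξ = {vbar ξ} ∧ AessR v ξ = {vbar ξ}) :
    ContinuousOn vbar J ∧ ∀ᵐ ξ : ℝ ∂volume, ξ ∈ J → vbar ξ = v ξ := by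
  obtain ⟨C, hC⟩ := hbd
  have h1 : ∀ ξ ∈ J, ∀ ε > (0:ℝ), ∃ r > (0:ℝ), ∀ᵐ x : ℝ ∂volume,
      x ∈ Ioo (ξ - r) (ξ + r) → dist (v x) (vbar ξ) < ε := by
    intro ξ hξ ε hε
    obtain ⟨r, hr, h⟩ := aux_close v C hC (fun r => Ioo (ξ - r) ξ)
      (fun a b hab => Ioo_subset_Ioo_left (by linarith)) _ (hcont ξ hξ).1 ε hε
    obtain ⟨r', hr', h'⟩ := aux_close v C hC (fun r => Ioo ξ (ξ + r))
      (fun a b hab => Ioo_subset_Ioo_right (by linarith)) _ (hcont ξ hξ).2 ε hε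
    refine ⟨min r r', lt_min hr hr', ?_⟩
    have hne : ∀ᵐ x : ℝ ∂volume, x ≠ ξ := by simp [ae_iff]
    filter_upwards [h, h', hne] with x hx hx' hxne hxI
    have := min_le_left r r'
    have := min_le_right r r'
    rcases lt_or_gt_of_ne hxne with hlt | hgt
    · exact hx ⟨by linarith [hxI.1], hlt⟩
    · exact hx' ⟨hgt, by linarith [hxI.2]⟩
  have h2 : ∀ ξ ∈ J, ∀ ε > (0:ℝ), ∃ r > (0:ℝ),
      (∀ᵐ x : ℝ ∂volume, x ∈ Ioo (ξ - r) (ξ + r) → dist (v x) (vbar ξ) < ε) ∧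
      ∀ η ∈ J, η ∈ Ioo (ξ - r) (ξ + r) → dist (vbar η) (vbar ξ) ≤ ε := by
    intro ξ hξ ε hε
    obtain ⟨r, hr, h⟩ := h1 ξ hξ ε hε
    refine ⟨r, hr, h, fun η hη hηI => ?_⟩
    by_contra hcon
    have hm : vbar η ∈ AessR v η := by rw [(hcont η hη).2]; exact rfl
    simp only [AessR, mem_iInter] at hm
    have hp := hm (ξ + r - η) (by linarith [hηI.2]) (Metric.closedBall (vbar ξ) ε)ᶜ
      Metric.isClosed_closedBall.isOpen_compl hcon
    refine hp.ne' (measure_mono_null ?_ h)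
    rintro x ⟨hx, hxI⟩ hx2
    exact hx (hx2 ⟨by linarith [hxI.1, hηI.1], by linarith [hxI.2]⟩).le
  refine ⟨?_, ?_⟩
  · rw [Metric.continuousOn_iff]
    intro ξ hξ ε hε
    obtain ⟨r, hr, -, h⟩ := h2 ξ hξ (ε / 2) (by linarith)
    refine ⟨r, hr, fun η hη hd => (h η hη ?_).trans_lt (by linarith)⟩
    rw [← Real.ball_eq_Ioo]
    exact hd
  · have h3 : ∀ k : ℕ, ∀ᵐ x : ℝ ∂volume, x ∈ J → dist (vbar x) (v x) < 1 / ((k:ℝ) + 1) := by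
      intro k
      rw [ae_iff]
      refine measure_null_of_locally_null _ fun ξ hξ => ?_
      have hk : (0:ℝ) < 1 / ((k:ℝ) + 1) := by positivity
      simp only [mem_setOf_eq, Classical.not_imp] at hξ
      obtain ⟨r, hr, h, h'⟩ := h2 ξ hξ.1 (1 / ((k:ℝ) + 1) / 2) (by linarith)
      refine ⟨_, inter_mem_nhdsWithin _ (Ioo_mem_nhds (a := ξ - r) (b := ξ + r)
        (by linarith) (by linarith)), measure_mono_null ?_ h⟩
      rintro x ⟨hx, hxI⟩ hx2
      simp only [mem_setOf_eq, Classical.not_imp] at hx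
      have e1 := hx2 hxI
      have e2 := h' x hx.1 hxI
      have e3 := dist_triangle_right (vbar x) (v x) (vbar ξ)
      exact hx.2 (by linarith)
    filter_upwards [ae_all_iff.2 h3] with x hx hxJ
    refine dist_le_zero.1 (le_of_forall_pos_lt_add fun ε hε => ?_)
    obtain ⟨k, hk⟩ := exists_nat_one_div_lt hε
    linarith [hx k hxJ]

end
end

section
/- Let f : U → ℝ^n be C² on an open set U ⊆ ℝ^n, let A := Df, let u⋆ ∈ U, and suppose λ⋆ ∈ ℝ is a simple root of the characteristic polynomial λ ↦ det(−λ I + A(u⋆)), with associated local C¹ characteristic speed map λ and eigenvector field r defined near u⋆ satisfying (−λ(u) I + A(u)) r(u) = 0 and λ(u⋆) = λ⋆. Then there exist an open interval I ⊆ ℝ containing 0, an open ball B ⊆ ℝ^{n−1} centered at 0, an open neighborhood V ⊆ U of u⋆, and a C¹ diffeomorphism G : I × B → V such that G(0,0) = u⋆, for each fixed z ∈ B the curve w ↦ G(w,z) satisfies ∂G/∂w (w,z) = r(G(w,z)), and, setting F := f ∘ G and μ := λ ∘ G, one has −μ ∂G/∂w + ∂F/∂w = 0 throughout I × B while the n×(n−1)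 matrix (−μ ∂G/∂z + ∂F/∂z)(0,0) has rank n−1. -/
open MeasureTheory Set Matrix

noncomputable section

section aux
open Topology Filter

/-- Pointwise application of a continuous family of operators. -/
def nemApp {K E F : Type*} [TopologicalSpace K] [CompactSpace K]
    [NormedAddCommGroup E] [NormedSpace ℝ E] [NormedAddCommGroup F] [NormedSpace ℝ F] :
    C(K, E →L[ℝ] F) →L[ℝ] C(K, E) →L[ℝ] C(K, F) :=
  LinearMap.mkContinuous₂
    (LinearMap.mk₂ ℝ (fun (D : C(K, E →L[ℝ] F)) (h : C(K, E)) =>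
        (⟨fun s => D s (h s), by fun_prop⟩ : C(K, F)))
      (by intros; ext; simp) (by intros; ext; simp) (by intros; ext; simp)
      (by intros; ext; simp)) 1
    (by
      intro D h
      rw [ContinuousMap.norm_le _ (by positivity)]
      intro s
      simp only [LinearMap.mk₂_apply, ContinuousMap.coe_mk, one_mul]
      refine (ContinuousLinearMap.le_opNorm _ _).trans ?_
      gcongr
      · exact D.norm_coe_le_norm s
      · exact h.norm_coe_le_norm s)

lemma nemApp_apply {K E F : Type*} [TopologicalSpace K] [CompactSpace K]
    [NormedAddCommGroup E] [NormedSpace ℝ E] [NormedAddCommGroup F] [NormedSpace ℝ F]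
    (D : C(K, E →L[ℝ] F)) (h : C(K, E)) (s : K) : nemApp D h s = D s (h s) := rfl

lemma nem_hasFDerivAt {K E F : Type*} [TopologicalSpace K] [CompactSpace K]
    [NormedAddCommGroup E] [NormedSpace ℝ E] [NormedAddCommGroup F] [NormedSpace ℝ F]
    (g : C(E, F)) (hg : ContDiff ℝ 1 g) (g' : C(E, E →L[ℝ] F)) (hg' : ∀ x, g' x = fderiv ℝ g x)
    (α : C(K, E)) :
    HasFDerivAt (fun α : C(K, E) => g.comp α) (nemApp (g'.comp α)) α := by
  rw [hasFDerivAt_iff_isLittleO_nhds_zero, Asymptotics.isLittleO_iff]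
  intro c hc
  have hcont : Continuous (fun β : C(K, E) => g'.comp β) := ContinuousMap.continuous_postcomp g'
  obtain ⟨δ, hδ, H⟩ := (Metric.continuous_iff (α := C(K, E)) (β := C(K, E →L[ℝ] F))).1 hcont α c hc
  filter_upwards [Metric.ball_mem_nhds (0 : C(K, E)) hδ] with h hh
  rw [mem_ball_zero_iff] at hh
  rw [ContinuousMap.norm_le _ (by positivity)]
  intro s
  have key : ∀ y ∈ Metric.ball (α s) δ, ‖fderiv ℝ g y - g' (α s)‖ ≤ c := by
    intro y hy
    have h1 : dist (α + ContinuousMap.const K (y - α s)) α < δ := by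
      rw [dist_eq_norm, add_sub_cancel_left]
      refine lt_of_le_of_lt ((ContinuousMap.norm_le _ (norm_nonneg _)).2 fun _ => le_rfl) ?_
      rwa [mem_ball_iff_norm] at hy
    have h2 := H _ h1
    have h3 := (ContinuousMap.dist_apply_le_dist s).trans h2.le
    simpa [dist_eq_norm, hg'] using h3
  have hs : ‖h s‖ < δ := (h.norm_coe_le_norm s).trans_lt hh
  have := (convex_ball (α s) δ).norm_image_sub_le_of_norm_fderiv_le' (𝕜 := ℝ) (f := g)
    (φ := g' (α s)) (x := α s) (y := α s + h s)
    (fun x _ => (hg.differentiable one_ne_zero) x) key (Metric.mem_ball_self hδ)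
    (by simpa [mem_ball_iff_norm] using hs)
  rw [add_sub_cancel_left] at this
  refine le_trans this ?_
  gcongr
  exact h.norm_coe_le_norm s

lemma nem_contDiff {K E F : Type*} [TopologicalSpace K] [CompactSpace K]
    [NormedAddCommGroup E] [NormedSpace ℝ E] [NormedAddCommGroup F] [NormedSpace ℝ F]
    (g : C(E, F)) (hg : ContDiff ℝ 1 g) :
    ContDiff ℝ 1 (fun α : C(K, E) => g.comp α) := by
  have hc : Continuous (fderiv ℝ g) := hg.continuous_fderiv one_ne_zero
  rw [contDiff_one_iff_hasFDerivAt]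
  refine ⟨fun α => nemApp ((⟨_, hc⟩ : C(E, E →L[ℝ] F)).comp α), ?_, fun α =>
    nem_hasFDerivAt g hg ⟨_, hc⟩ (fun _ => rfl) α⟩
  exact nemApp.continuous.comp (ContinuousMap.continuous_postcomp _)

/-- Primitive operator. -/
def primOp (E : Type*) [NormedAddCommGroup E] [NormedSpace ℝ E] :
    C(unitInterval, E) →L[ℝ] C(unitInterval, E) :=
  LinearMap.mkContinuous
    { toFun := fun α => ⟨fun t => ∫ s in (0:ℝ)..t, IccExtend zero_le_one α s, by
        have h : Continuous (IccExtend (zero_le_one : (0:ℝ) ≤ 1) α) := α.continuous.Icc_extend'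
        have := intervalIntegral.continuous_primitive (μ := volume)
          (fun a b => h.intervalIntegrable a b) 0
        exact this.comp continuous_subtype_val⟩
      map_add' := by
        intro α β
        ext t
        have h (α : C(unitInterval, E)) : Continuous (IccExtend (zero_le_one : (0:ℝ) ≤ 1) α) :=
          α.continuous.Icc_extend'
        simp only [ContinuousMap.coe_mk, ContinuousMap.add_apply]
        rw [← intervalIntegral.integral_add ((h α).intervalIntegrable _ _)
          ((h β).intervalIntegrable _ _)]
        rfl
      map_smul' := by
        intro c α
        ext t
        simp only [ContinuousMap.coe_mk, ContinuousMap.smul_apply, RingHom.id_apply]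
        rw [← intervalIntegral.integral_smul]
        rfl } 1
    (by
      intro α
      rw [ContinuousMap.norm_le _ (by positivity)]
      intro t
      have := intervalIntegral.norm_integral_le_of_norm_le_const (a := 0) (b := (t:ℝ)) (C := ‖α‖)
        (f := IccExtend zero_le_one α) (fun s _ => α.norm_coe_le_norm _)
      refine this.trans ?_
      rw [mul_comm]
      gcongr
      rw [sub_zero, abs_of_nonneg t.2.1]; exact t.2.2)

lemma primOp_apply {E : Type*} [NormedAddCommGroup E] [NormedSpace ℝ E]
    (α : C(unitInterval, E)) (t : unitInterval) :
    primOp E α t = ∫ s in (0:ℝ)..t, IccExtend zero_le_one α s := rfl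

lemma exists_eq_equiv {n : ℕ} (hn : n ≠ 0) (v : Fin n → ℝ) (hv : v ≠ 0) :
    ∃ e : (ℝ × (Fin (n-1) → ℝ)) ≃L[ℝ] (Fin n → ℝ), e (1, 0) = v := by
  have hd : Module.finrank ℝ (ℝ × (Fin (n-1) → ℝ)) = Module.finrank ℝ (Fin n → ℝ) := by
    simp; omega
  let e0 := ContinuousLinearEquiv.ofFinrankEq hd
  obtain ⟨A, hA⟩ := SeparatingDual.exists_continuousLinearEquiv_apply_eq (R := ℝ)
    (x := e0 (1, 0)) (y := v) (by simp) hv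
  exact ⟨e0.trans A, hA⟩

lemma ker_of_simple {n : ℕ} (A : (Fin n → ℝ) →ₗ[ℝ] (Fin n → ℝ)) (l : ℝ)
    (hs : deriv (fun t : ℝ => LinearMap.det (-(t • (LinearMap.id : (Fin n → ℝ) →ₗ[ℝ] (Fin n → ℝ)))
      + A)) l ≠ 0) (v : Fin n → ℝ) (hv : v ≠ 0) (hAv : A v = l • v) (x : Fin n → ℝ)
    (hx : A x = l • x) : ∃ c : ℝ, x = c • v := by
  have h1 : (fun t : ℝ => LinearMap.det (-(t • (LinearMap.id : (Fin n → ℝ) →ₗ[ℝ] (Fin n → ℝ)))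
      + A)) = fun t => (-1) ^ n * A.charpoly.eval t := by
    ext t
    rw [LinearMap.eval_charpoly]
    have : -(t • (LinearMap.id : (Fin n → ℝ) →ₗ[ℝ] (Fin n → ℝ))) + A
      = (-1 : ℝ) • (algebraMap ℝ (Module.End ℝ (Fin n → ℝ)) t - A) := by
      ext; simp [Module.algebraMap_end_apply]; ring
    rw [this, LinearMap.det_smul]
    simp
  rw [h1, deriv_const_mul _ (Polynomial.differentiable _ _), Polynomial.deriv] at hs
  have h2 : A.charpoly.rootMultiplicity l ≤ 1 := by
    by_contra! h
    have := (Polynomial.one_lt_rootMultiplicity_iff_isRoot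
      (LinearMap.charpoly_monic A).ne_zero).1 h
    apply hs
    rw [this.2.eq_zero, mul_zero]
  have h3 : Module.finrank ℝ (Module.End.eigenspace A l) ≤ 1 :=
    (LinearMap.finrank_eigenspace_le A l).trans h2
  have hv' : v ∈ Module.End.eigenspace A l := Module.End.mem_eigenspace_iff.2 hAv
  have hx' : x ∈ Module.End.eigenspace A l := Module.End.mem_eigenspace_iff.2 hx
  have h4 : Module.finrank ℝ (Module.End.eigenspace A l) = 1 := by
    refine le_antisymm h3 ?_
    exact Module.finrank_pos_iff_exists_ne_zero.2 ⟨⟨v, hv'⟩, by simpa [Subtype.ext_iff] using hv⟩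
  obtain ⟨c, hc⟩ := (finrank_eq_one_iff_of_nonzero' (⟨v, hv'⟩ : Module.End.eigenspace A l)
    (by simpa [Subtype.ext_iff] using hv)).1 h4 ⟨x, hx'⟩
  exact ⟨c, (congrArg Subtype.val hc).symm⟩

lemma cutoff {n : ℕ} (V : Set (Fin n → ℝ)) (hV : IsOpen V) (u : Fin n → ℝ) (hu : u ∈ V)
    (r : (Fin n → ℝ) → (Fin n → ℝ)) (hr : ContDiffOn ℝ 1 r V) :
    ∃ R : (Fin n → ℝ) → (Fin n → ℝ), ContDiff ℝ 1 R ∧ ∃ W ⊆ V, IsOpen W ∧ u ∈ W ∧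
      ∀ x ∈ W, R x = r x := by
  obtain ⟨ε, hε, hb⟩ := Metric.isOpen_iff.1 hV u hu
  let χ : ContDiffBump u := ⟨ε / 4, ε / 2, by positivity, by linarith⟩
  refine ⟨fun x => χ x • r x, ?_, Metric.ball u (ε / 4), ?_, Metric.isOpen_ball,
    Metric.mem_ball_self (by positivity), ?_⟩
  · rw [contDiff_iff_contDiffAt]
    intro x
    by_cases hx : x ∈ V
    · exact χ.contDiffAt.smul (hr.contDiffAt (hV.mem_nhds hx))
    · have hx' : x ∉ tsupport χ := by
        rw [χ.tsupport_eq]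
        intro h
        apply hx
        apply hb
        exact Metric.closedBall_subset_ball (by change ε / 2 < ε; linarith) h
      have : (fun x => χ x • r x) =ᶠ[𝓝 x] fun _ => 0 := by
        filter_upwards [notMem_tsupport_iff_eventuallyEq.1 hx'] with y hy
        simp [hy]
      exact contDiffAt_const.congr_of_eventuallyEq this
  · exact (Metric.ball_subset_ball (by linarith)).trans hb
  · intro x hx
    have := χ.one_of_mem_closedBall (Metric.ball_subset_closedBall hx)
    simp [this]

lemma exists_flow {E : Type*} [NormedAddCommGroup E] [NormedSpace ℝ E] [CompleteSpace E]
    (r : E → E) (hr : ContDiff ℝ 1 r) (x0 : E) :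
    ∃ ε > 0, ∃ Φ : ℝ × E → E, ContDiffOn ℝ 1 Φ (Metric.ball (0, x0) ε) ∧
      (∀ x ∈ Metric.ball x0 ε, Φ (0, x) = x) ∧
      ∀ q ∈ Metric.ball ((0 : ℝ), x0) ε, fderiv ℝ Φ q (1, 0) = r (Φ q) := by
  let rr : C(E, E) := ⟨r, hr.continuous⟩
  let N : C(unitInterval, E) → C(unitInterval, E) := fun α => rr.comp α
  have hN : ContDiff ℝ 1 N := nem_contDiff rr hr
  let cst : E →L[ℝ] C(unitInterval, E) := ContinuousLinearMap.const ℝ unitInterval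
  have hcst : ∀ x t, cst x t = x := fun _ _ => rfl
  let T : ℝ × E × C(unitInterval, E) → ℝ × E × C(unitInterval, E) := fun p =>
    (p.1, p.2.1, p.2.2 - cst p.2.1 - p.1 • primOp E (N p.2.2))
  have hT : ContDiff ℝ 1 T := by
    have h1 : ContDiff ℝ 1 (fun p : ℝ × E × C(unitInterval, E) => primOp E (N p.2.2)) :=
      (primOp E).contDiff.comp (hN.comp (contDiff_snd.comp contDiff_snd))
    have h2 : ContDiff ℝ 1 (fun p : ℝ × E × C(unitInterval, E) => cst p.2.1) :=
      cst.contDiff.comp (contDiff_fst.comp contDiff_snd)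
    have h3 : ContDiff ℝ 1 (fun p : ℝ × E × C(unitInterval, E) => p.2.2) := contDiff_snd.comp contDiff_snd
    exact contDiff_fst.prodMk ((contDiff_fst.comp contDiff_snd).prodMk
      ((h3.sub h2).sub (contDiff_fst.smul h1)))
  let p0 : ℝ × E × C(unitInterval, E) := (0, x0, cst x0)
  let c : C(unitInterval, E) := primOp E (N (cst x0))
  let a1 : ℝ × E × C(unitInterval, E) →L[ℝ] ℝ := ContinuousLinearMap.fst ℝ ℝ (E × C(unitInterval, E))
  let a2 : ℝ × E × C(unitInterval, E) →L[ℝ] E :=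
    (ContinuousLinearMap.fst ℝ E C(unitInterval, E)).comp (ContinuousLinearMap.snd ℝ ℝ (E × C(unitInterval, E)))
  let a3 : ℝ × E × C(unitInterval, E) →L[ℝ] C(unitInterval, E) :=
    (ContinuousLinearMap.snd ℝ E C(unitInterval, E)).comp (ContinuousLinearMap.snd ℝ ℝ (E × C(unitInterval, E)))
  let T' : (ℝ × E × C(unitInterval, E)) ≃L[ℝ] (ℝ × E × C(unitInterval, E)) := ContinuousLinearEquiv.equivOfInverse
    (a1.prod (a2.prod (a3 - cst.comp a2 - a1.smulRight c)))
    (a1.prod (a2.prod (a3 + cst.comp a2 + a1.smulRight c)))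
    (by rintro ⟨w, x, h⟩; simp [a1, a2, a3]; abel)
    (by rintro ⟨w, x, h⟩; simp [a1, a2, a3]; abel)
  have hT' : HasFDerivAt T (T' : (ℝ × E × C(unitInterval, E)) →L[ℝ] (ℝ × E × C(unitInterval, E))) p0 := by
    have h1 : DifferentiableAt ℝ (fun p : ℝ × E × C(unitInterval, E) => primOp E (N p.2.2)) p0 :=
      ((primOp E).contDiff.comp (hN.comp (contDiff_snd.comp contDiff_snd))).contDiffAt.differentiableAt
        one_ne_zero
    have h2 := (a1.hasFDerivAt (x := p0)).smul h1.hasFDerivAt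
    have h3 := (a1.hasFDerivAt (x := p0)).prodMk ((a2.hasFDerivAt (x := p0)).prodMk
      (((a3.hasFDerivAt (x := p0)).sub (cst.comp a2).hasFDerivAt).sub h2))
    refine h3.congr_fderiv ?_
    ext q <;> simp [T', a1, a2, a3, p0, c]
  have hTp0 : T p0 = (0, x0, 0) := by simp [T, p0]
  let e := hT.contDiffAt.toOpenPartialHomeomorph T hT' one_ne_zero
  have he : ∀ p, e p = T p := fun _ => rfl
  have hsrc : p0 ∈ e.source := hT.contDiffAt.mem_toOpenPartialHomeomorph_source hT' one_ne_zero
  have htgt : ((0 : ℝ), x0, (0 : C(unitInterval, E))) ∈ e.target := by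
    rw [← hTp0]; exact e.map_source hsrc
  have hsymm0 : e.symm (0, x0, 0) = p0 := by
    rw [← hTp0]; exact e.left_inv hsrc
  have hS : ContDiffAt ℝ 1 e.symm (0, x0, 0) := by
    apply e.contDiffAt_symm htgt (f₀' := T')
    · rw [hsymm0]; exact hT'
    · exact hT.contDiffAt
  obtain ⟨δ, hδ, hδs⟩ := Metric.isOpen_iff.1 e.open_source p0 hsrc
  have hj : ContDiff ℝ 1 (fun q : ℝ × E => ((q.1, q.2, 0) : ℝ × E × C(unitInterval, E))) := by fun_prop
  have hev : ∀ᶠ q : ℝ × E in 𝓝 (0, x0), (q.1, q.2, (0 : C(unitInterval, E))) ∈ e.target ∧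
      e.symm (q.1, q.2, 0) ∈ Metric.ball p0 δ ∧ ContDiffAt ℝ 1 e.symm (q.1, q.2, 0) := by
    have ht : Tendsto (fun q : ℝ × E => ((q.1, q.2, 0) : ℝ × E × C(unitInterval, E))) (𝓝 (0, x0))
        (𝓝 (0, x0, 0)) := hj.continuous.tendsto' _ _ rfl
    refine ht.eventually (p := fun y => y ∈ e.target ∧ e.symm y ∈ Metric.ball p0 δ ∧
      ContDiffAt ℝ 1 e.symm y) ?_
    have v1 : ∀ᶠ y in 𝓝 ((0 : ℝ), x0, (0 : C(unitInterval, E))), e.symm y ∈ Metric.ball p0 δ :=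
      hS.continuousAt.eventually_mem (by rw [hsymm0]; exact Metric.ball_mem_nhds p0 hδ)
    filter_upwards [e.open_target.mem_nhds htgt, v1, hS.eventually (by simp)] with y y1 y2 y3
    exact ⟨y1, y2, y3⟩
  obtain ⟨ε, hε, hball⟩ := Metric.eventually_nhds_iff_ball.1 hev
  let Φ : ℝ × E → E := fun q => (e.symm (q.1, q.2, 0)).2.2 1
  have hΦ : ∀ q ∈ Metric.ball ((0 : ℝ), x0) ε, ContDiffAt ℝ 1 Φ q := by
    intro q hq
    have h1 : ContDiffAt ℝ 1 (fun q : ℝ × E => e.symm (q.1, q.2, 0)) q :=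
      ContDiffAt.comp q (g := e.symm) (hball q hq).2.2 hj.contDiffAt
    exact ((ContinuousMap.evalCLM ℝ (1 : unitInterval)).contDiff.contDiffAt).comp q
      h1.snd.snd
  have hmem : ∀ {w : ℝ} {x : E}, (w, x) ∈ Metric.ball ((0 : ℝ), x0) ε ↔ |w| < ε ∧ dist x x0 < ε := by
    intro w x
    simp [Prod.dist_eq]
  -- structure of the solution
  have hsol : ∀ w x, (w, x) ∈ Metric.ball ((0 : ℝ), x0) ε → ∃ α : C(unitInterval, E),
      e.symm (w, x, 0) = (w, x, α) ∧ (w, x, α) ∈ Metric.ball p0 δ ∧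
      ∀ t : unitInterval, α t = x + w • ∫ s in (0:ℝ)..t, r (IccExtend zero_le_one α s) := by
    intro w x hq
    obtain ⟨h1, h2, -⟩ := hball _ hq
    have h3 := e.right_inv h1
    rw [he] at h3
    simp only at h2 h3
    rcases hh : e.symm (w, x, 0) with ⟨w', x', α⟩
    rw [hh] at h2 h3
    simp only [T, Prod.mk.injEq] at h3
    obtain ⟨rfl, rfl, h5⟩ := h3
    refine ⟨α, rfl, h2, fun t => ?_⟩
    have h6 := congrArg (fun β : C(unitInterval, E) => β t) h5
    simp only [ContinuousMap.sub_apply, ContinuousMap.smul_apply, hcst, primOp_apply,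
      ContinuousMap.zero_apply] at h6
    rw [sub_sub, sub_eq_zero] at h6
    exact h6
  have hscale : ∀ w x, (w, x) ∈ Metric.ball ((0 : ℝ), x0) ε → ∃ α : C(unitInterval, E), ∀ t : unitInterval,
      α t = Φ (t * w, x) ∧
      α t = x + w • ∫ s in (0:ℝ)..t, r (IccExtend zero_le_one α s) := by
    intro w x hq
    obtain ⟨α, h1, h2, h3⟩ := hsol w x hq
    refine ⟨α, fun σ => ⟨?_, h3 σ⟩⟩
    let β : C(unitInterval, E) := ⟨fun t => α (σ * t), by fun_prop⟩
    have hβ : ((σ : ℝ) * w, x, β) ∈ Metric.ball p0 δ := by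
      simp only [p0, Metric.mem_ball, dist_eq_norm, Prod.mk_sub_mk, Prod.norm_def, max_lt_iff, sub_zero] at h2 ⊢
      refine ⟨lt_of_le_of_lt ?_ h2.1, h2.2.1, lt_of_le_of_lt ?_ h2.2.2⟩
      · rw [norm_mul]
        exact mul_le_of_le_one_left (norm_nonneg _)
          (by rw [Real.norm_eq_abs, abs_of_nonneg σ.2.1]; exact σ.2.2)
      · rw [ContinuousMap.norm_le _ (norm_nonneg _)]
        intro t
        exact (α - cst x0).norm_coe_le_norm (σ * t)
    have hTβ : e ((σ : ℝ) * w, x, β) = ((σ : ℝ) * w, x, 0) := by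
      rw [he]
      simp only [T, Prod.mk.injEq, true_and]
      ext t
      simp only [ContinuousMap.sub_apply, ContinuousMap.smul_apply, hcst, primOp_apply,
        ContinuousMap.zero_apply]
      rw [sub_sub, sub_eq_zero]
      change α (σ * t) = _
      rw [h3, mul_comm (σ : ℝ) w, mul_smul, Icc.coe_mul]
      congr 2
      have := intervalIntegral.smul_integral_comp_mul_left (a := 0) (b := (t : ℝ))
        (fun s => r (IccExtend zero_le_one α s)) (σ : ℝ)
      rw [mul_zero] at this
      rw [← this]
      congr 1
      apply intervalIntegral.integral_congr
      intro s hs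
      rw [uIcc_of_le t.2.1] at hs
      have hs' : s ∈ Icc (0:ℝ) 1 := ⟨hs.1, hs.2.trans t.2.2⟩
      have hs2 : (σ : ℝ) * s ∈ Icc (0:ℝ) 1 :=
        ⟨mul_nonneg σ.2.1 hs'.1, mul_le_one₀ σ.2.2 hs'.1 hs'.2⟩
      simp only
      rw [IccExtend_of_mem _ _ hs', IccExtend_of_mem _ _ hs2]
      rfl
    have h4 : e.symm ((σ : ℝ) * w, x, 0) = ((σ : ℝ) * w, x, β) := by
      rw [← hTβ]; exact e.left_inv (hδs hβ)
    simp only [Φ, h4]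
    change _ = α (σ * 1)
    rw [mul_one]
  have hne : ∀ w x, (w, x) ∈ Metric.ball ((0 : ℝ), x0) ε → w ≠ 0 →
      fderiv ℝ Φ (w, x) (1, 0) = r (Φ (w, x)) := by
    intro w x hq hw
    obtain ⟨α, hα⟩ := hscale w x hq
    have hext : Continuous (fun s => r (IccExtend (zero_le_one : (0:ℝ) ≤ 1) α s)) :=
      hr.continuous.comp α.continuous.Icc_extend'
    have d1 : HasDerivAt (fun σ : ℝ => x + w • ∫ s in (0:ℝ)..σ, r (IccExtend zero_le_one α s))
        (w • r (IccExtend zero_le_one α 1)) 1 :=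
      ((hext.integral_hasStrictDerivAt 0 1).hasDerivAt.const_smul w).const_add x
    have d2 : HasDerivAt (fun σ : ℝ => Φ (σ * w, x)) (fderiv ℝ Φ (w, x) (w, 0)) 1 := by
      have i1 : HasDerivAt (fun σ : ℝ => (σ * w, x)) (w, (0 : E)) 1 := by
        have := (hasDerivAt_id (1:ℝ)).mul_const w
        rw [one_mul] at this
        exact this.prodMk (hasDerivAt_const _ _)
      have i2 : HasFDerivAt Φ (fderiv ℝ Φ (w, x)) ((1:ℝ) * w, x) := by
        rw [one_mul]; exact ((hΦ _ hq).differentiableAt one_ne_zero).hasFDerivAt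
      exact i2.comp_hasDerivAt (1:ℝ) i1
    have heq : ∀ σ ∈ Icc (0:ℝ) 1, Φ (σ * w, x) =
        x + w • ∫ s in (0:ℝ)..σ, r (IccExtend zero_le_one α s) := by
      intro σ hσ
      have := hα ⟨σ, hσ⟩
      exact this.1.symm.trans this.2
    have d3 := d1.hasDerivWithinAt (s := Icc 0 1) |>.congr heq
      (heq 1 (right_mem_Icc.2 zero_le_one))
    have d4 := (uniqueDiffOn_Icc (zero_lt_one' ℝ) 1 (right_mem_Icc.2 zero_le_one)).eq_deriv _
      d3 (d2.hasDerivWithinAt (s := Icc 0 1))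
    have h5 : ((w, 0) : ℝ × E) = w • (1, 0) := by simp
    have h6 : IccExtend (zero_le_one : (0:ℝ) ≤ 1) α 1 = Φ (w, x) := by
      rw [IccExtend_of_mem _ _ (right_mem_Icc.2 zero_le_one)]
      have := (hα ⟨1, right_mem_Icc.2 zero_le_one⟩).1
      simpa using this
    rw [h5, map_smul, h6] at d4
    exact ((smul_right_injective E hw) d4).symm
  refine ⟨ε, hε, Φ, fun q hq => (hΦ q hq).contDiffWithinAt, ?_, ?_⟩
  · intro x hx
    obtain ⟨α, hα⟩ := hscale 0 x (hmem.2 ⟨by simpa using hε, hx⟩)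
    have := hα 0
    simp only [mul_zero, zero_smul, add_zero] at this
    exact this.1.symm.trans this.2
  · rintro ⟨w, x⟩ hq
    by_cases hw : w = 0
    · subst hw
      have c1 : ContinuousAt (fun t : ℝ => fderiv ℝ Φ (t, x) (1, 0)) 0 := by
        have i1 : ContinuousAt (fderiv ℝ Φ) (0, x) :=
          ((hΦ _ hq).fderiv_right (m := 0) (by simp)).continuousAt
        have i2 : ContinuousAt (fun t : ℝ => fderiv ℝ Φ (t, x)) 0 :=
          ContinuousAt.comp (f := fun t : ℝ => (t, x)) i1 (by fun_prop)
        exact i2.clm_apply continuousAt_const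
      have c2 : ContinuousAt (fun t : ℝ => r (Φ (t, x))) 0 := by
        have i2 : ContinuousAt (fun t : ℝ => Φ (t, x)) 0 :=
          ContinuousAt.comp (f := fun t : ℝ => (t, x)) (hΦ _ hq).continuousAt (by fun_prop)
        exact ContinuousAt.comp (f := fun t : ℝ => Φ (t, x)) hr.continuous.continuousAt i2
      have c3 : (fun t : ℝ => fderiv ℝ Φ (t, x) (1, 0)) =ᶠ[𝓝[≠] 0] fun t => r (Φ (t, x)) := by
        have : ∀ᶠ t : ℝ in 𝓝 0, (t, x) ∈ Metric.ball ((0 : ℝ), x0) ε := by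
          have i3 : ContinuousAt (fun t : ℝ => (t, x)) 0 := by fun_prop
          exact i3.eventually_mem (Metric.isOpen_ball.mem_nhds hq)
        filter_upwards [nhdsWithin_le_nhds this, self_mem_nhdsWithin] with t ht ht0
        exact hne t x ht ht0
      exact tendsto_nhds_unique (c1.tendsto.mono_left nhdsWithin_le_nhds)
        ((c2.tendsto.mono_left nhdsWithin_le_nhds).congr' c3.symm)
    · exact hne w x hq hw

end aux

/-- Straightening rarefaction integral curves: given a local `C¹`
characteristic pair `(λ, r)` at `u⋆`, there is a `C¹` diffeomorphism
`G : I × B → V` with `G(0,0) = u⋆` whose `w`-curves are rarefaction integral curves,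
`−μ ∂G/∂w + ∂(f∘G)/∂w = 0` on `I × B`, and `(−μ ∂G/∂z + ∂(f∘G)/∂z)(0,0)` has
rank `n − 1`. -/
theorem straightening_rarefaction_integral_curves
    {n : ℕ} (U : Set (Fin n → ℝ)) (hU : IsOpen U)
    (f : (Fin n → ℝ) → (Fin n → ℝ)) (hf : ContDiffOn ℝ 2 f U)
    (us : Fin n → ℝ) (hus : us ∈ U) (lams : ℝ)
    (hroot : detShift f lams us = 0)
    (hsimple : deriv (fun t : ℝ => detShift f t us) lams ≠ 0)
    (V₀ : Set (Fin n → ℝ)) (hV₀ : IsOpen V₀) (husV₀ : us ∈ V₀) (hV₀U : V₀ ⊆ U)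
    (lam : (Fin n → ℝ) → ℝ) (r : (Fin n → ℝ) → (Fin n → ℝ))
    (hlam : ContDiffOn ℝ 1 lam V₀) (hr : ContDiffOn ℝ 1 r V₀)
    (hlamus : lam us = lams)
    (heig : ∀ u ∈ V₀, r u ≠ 0 ∧ (-(lam u)) • r u + fderiv ℝ f u (r u) = 0) :
    ∃ I : Set ℝ, IsOpen I ∧ I.OrdConnected ∧ (0:ℝ) ∈ I ∧
    ∃ ρ > (0:ℝ), ∃ V : Set (Fin n → ℝ), IsOpen V ∧ us ∈ V ∧ V ⊆ V₀ ∧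
    ∃ G : ℝ × (Fin (n-1) → ℝ) → (Fin n → ℝ),
      ContDiffOn ℝ 1 G (I ×ˢ Metric.ball (0 : Fin (n-1) → ℝ) ρ) ∧
      Set.BijOn G (I ×ˢ Metric.ball (0 : Fin (n-1) → ℝ) ρ) V ∧
      (∃ Ginv : (Fin n → ℝ) → ℝ × (Fin (n-1) → ℝ), ContDiffOn ℝ 1 Ginv V ∧
        ∀ q ∈ I ×ˢ Metric.ball (0 : Fin (n-1) → ℝ) ρ, Ginv (G q) = q) ∧
      G (0, 0) = us ∧
      (∀ q ∈ I ×ˢ Metric.ball (0 : Fin (n-1) → ℝ) ρ,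
        fderiv ℝ G q ((1:ℝ), (0 : Fin (n-1) → ℝ)) = r (G q)) ∧
      (∀ q ∈ I ×ˢ Metric.ball (0 : Fin (n-1) → ℝ) ρ,
        (-(lam (G q))) • (fderiv ℝ G q ((1:ℝ), (0 : Fin (n-1) → ℝ)))
          + fderiv ℝ (f ∘ G) q ((1:ℝ), (0 : Fin (n-1) → ℝ)) = 0) ∧
      Module.finrank ℝ (LinearMap.range
          (((-(lam us) • fderiv ℝ G ((0:ℝ), (0 : Fin (n-1) → ℝ))
              + fderiv ℝ (f ∘ G) ((0:ℝ), (0 : Fin (n-1) → ℝ))).comp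
            (ContinuousLinearMap.inr ℝ ℝ (Fin (n-1) → ℝ))).toLinearMap)) = n - 1 := by
  have hn : n ≠ 0 := by
    rintro rfl
    exact (heig us husV₀).1 (Subsingleton.elim _ _)
  obtain ⟨R, hR, W, hWV, hW, husW, hRW⟩ := cutoff V₀ hV₀ us husV₀ r hr
  obtain ⟨ε, hε, Φ, hΦ, hΦ0, hΦr⟩ := exists_flow R hR us
  obtain ⟨e, he⟩ := exists_eq_equiv hn (r us) (heig us husV₀).1
  let j : ℝ × (Fin (n-1) → ℝ) → ℝ × (Fin n → ℝ) := fun q => (q.1, us + e (0, q.2))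
  let j' : ℝ × (Fin (n-1) → ℝ) →L[ℝ] ℝ × (Fin n → ℝ) :=
    (ContinuousLinearMap.fst ℝ _ _).prod ((e : _ →L[ℝ] (Fin n → ℝ)).comp
      ((ContinuousLinearMap.inr ℝ ℝ (Fin (n-1) → ℝ)).comp (ContinuousLinearMap.snd ℝ _ _)))
  have hjj : j = fun q => (0, us) + j' q := by
    ext q <;> simp [j, j']
  have hjd : ∀ q, HasFDerivAt j j' q := by
    intro q
    rw [hjj]
    exact j'.hasFDerivAt.const_add _
  have hjc : ContDiff ℝ 1 j := by
    rw [hjj]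
    exact contDiff_const.add j'.contDiff
  have hj0 : j (0, 0) = (0, us) := by
    have : j' (0, 0) = 0 := map_zero j'
    simp [hjj, this]
  let G : ℝ × (Fin (n-1) → ℝ) → (Fin n → ℝ) := Φ ∘ j
  -- the set where everything about `G` works
  let S : Set (ℝ × (Fin (n-1) → ℝ)) := j ⁻¹' Metric.ball (0, us) ε
  have hSo : IsOpen S := Metric.isOpen_ball.preimage hjc.continuous
  have h0S : ((0 : ℝ), (0 : Fin (n-1) → ℝ)) ∈ S := by
    change j (0, 0) ∈ Metric.ball (0, us) ε
    rw [hj0]; exact Metric.mem_ball_self hε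
  have hGc : ∀ q ∈ S, ContDiffAt ℝ 1 G q := by
    intro q hq
    exact (hΦ.contDiffAt (Metric.isOpen_ball.mem_nhds hq)).comp q hjc.contDiffAt
  have hG0 : G (0, 0) = us := by
    change Φ (j (0, 0)) = us
    rw [hj0]; exact hΦ0 us (Metric.mem_ball_self hε)
  have hGr : ∀ q ∈ S, fderiv ℝ G q (1, 0) = R (G q) := by
    intro q hq
    have h1 : HasFDerivAt Φ (fderiv ℝ Φ (j q)) (j q) :=
      ((hΦ.contDiffAt (Metric.isOpen_ball.mem_nhds hq)).differentiableAt one_ne_zero).hasFDerivAt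
    have h2 := (h1.comp q (hjd q)).fderiv
    have h3 : j' (1, 0) = (1, 0) := by
      simp [j']
    change fderiv ℝ (Φ ∘ j) q (1, 0) = _
    rw [h2, ContinuousLinearMap.comp_apply, h3]
    exact hΦr _ hq
  have hGd0 : HasFDerivAt G (fderiv ℝ G (0, 0)) (0, 0) :=
    ((hGc _ h0S).differentiableAt one_ne_zero).hasFDerivAt
  have hGz : ∀ z, fderiv ℝ G (0, 0) (0, z) = e (0, z) := by
    intro z
    have i1 : HasFDerivAt (fun z : Fin (n-1) → ℝ => G (0, z))
        ((fderiv ℝ G (0, 0)).comp (ContinuousLinearMap.inr ℝ ℝ _)) 0 :=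
      HasFDerivAt.comp (0 : Fin (n-1) → ℝ) (f := fun z : Fin (n-1) → ℝ => ((0 : ℝ), z)) hGd0
        (hasFDerivAt_prodMk_right _ _)
    have i2 : HasFDerivAt (fun z : Fin (n-1) → ℝ => us + e (0, z))
        ((e : _ →L[ℝ] (Fin n → ℝ)).comp (ContinuousLinearMap.inr ℝ ℝ _)) 0 :=
      ((e : (ℝ × (Fin (n-1) → ℝ)) →L[ℝ] (Fin n → ℝ)).comp
        (ContinuousLinearMap.inr ℝ ℝ (Fin (n-1) → ℝ))).hasFDerivAt.const_add us
    have i3 : (fun z : Fin (n-1) → ℝ => G (0, z)) =ᶠ[nhds 0] fun z => us + e (0, z) := by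
      have hc : ContinuousAt (fun z : Fin (n-1) → ℝ => us + e (0, z)) 0 := i2.continuousAt
      have := hc.eventually_mem (s := Metric.ball us ε)
        (Metric.isOpen_ball.mem_nhds (by
          have : e ((0 : ℝ), (0 : Fin (n-1) → ℝ)) = 0 := map_zero e
          simpa [this] using hε))
      filter_upwards [this] with z hz
      exact hΦ0 _ hz
    have i4 := i1.unique (i2.congr_of_eventuallyEq i3)
    exact congrArg (fun L => L z) i4
  have hGe : fderiv ℝ G (0, 0) = (e : _ →L[ℝ] (Fin n → ℝ)) := by
    apply ContinuousLinearMap.ext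
    rintro ⟨w, z⟩
    have h1 : ((w, z) : ℝ × (Fin (n-1) → ℝ)) = w • (1, 0) + (0, z) := by simp
    have h2 : fderiv ℝ G (0, 0) (1, 0) = e (1, 0) := by
      rw [hGr _ h0S, hG0, hRW us husW, he]
    rw [h1, map_add, map_add, map_smul, map_smul, h2, hGz]
    rfl
  rw [hGe] at hGd0
  let P := (hGc _ h0S).toOpenPartialHomeomorph G hGd0 one_ne_zero
  have hPG : ∀ q, P q = G q := fun _ => rfl
  have h0P : (0, 0) ∈ P.source := (hGc _ h0S).mem_toOpenPartialHomeomorph_source hGd0 one_ne_zero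
  have hsymm0 : P.symm us = (0, 0) := by
    have := P.left_inv h0P
    rwa [hPG, hG0] at this
  have hPs : ContDiffAt ℝ 1 P.symm us := by
    apply P.contDiffAt_symm (f₀' := e)
    · have := P.map_source h0P
      rwa [hPG, hG0] at this
    · rw [hsymm0]; exact hGd0
    · rw [hsymm0]; exact hGc _ h0S
  have hev : ∀ᶠ q in nhds ((0 : ℝ), (0 : Fin (n-1) → ℝ)), q ∈ S ∧ q ∈ P.source ∧ G q ∈ W ∧
      ContDiffAt ℝ 1 P.symm (G q) := by
    have hcont : ContinuousAt G (0, 0) := (hGc _ h0S).continuousAt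
    have v1 : ∀ᶠ q in nhds ((0 : ℝ), (0 : Fin (n-1) → ℝ)), G q ∈ W :=
      hcont.eventually_mem (hW.mem_nhds (by rw [hG0]; exact husW))
    have v2 : ∀ᶠ q in nhds ((0 : ℝ), (0 : Fin (n-1) → ℝ)), ContDiffAt ℝ 1 P.symm (G q) := by
      have := hPs.eventually (by simp)
      rw [← hG0] at this
      exact hcont.eventually this
    filter_upwards [hSo.mem_nhds h0S, P.open_source.mem_nhds h0P, v1, v2] with q q1 q2 q3 q4
    exact ⟨q1, q2, q3, q4⟩
  obtain ⟨ρ, hρ, hb⟩ := Metric.eventually_nhds_iff_ball.1 hev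
  have hQ : Metric.ball (0 : ℝ) ρ ×ˢ Metric.ball (0 : Fin (n-1) → ℝ) ρ
      = Metric.ball ((0 : ℝ), (0 : Fin (n-1) → ℝ)) ρ := ball_prod_same _ _ _
  have hcomp : ∀ q, q ∈ S → G q ∈ W → fderiv ℝ (f ∘ G) q = (fderiv ℝ f (G q)).comp (fderiv ℝ G q) := by
    intro q hq hq'
    have hd : DifferentiableAt ℝ f (G q) :=
      (hf.contDiffAt (hU.mem_nhds (hV₀U (hWV hq')))).differentiableAt two_ne_zero
    exact fderiv_comp q hd ((hGc q hq).differentiableAt one_ne_zero)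
  refine ⟨Metric.ball 0 ρ, Metric.isOpen_ball, ?_, Metric.mem_ball_self hρ, ρ, hρ,
    G '' (Metric.ball ((0 : ℝ), (0 : Fin (n-1) → ℝ)) ρ), ?_, ?_, ?_, G, ?_⟩
  · rw [Real.ball_eq_Ioo]; exact ordConnected_Ioo
  · exact P.isOpen_image_of_subset_source Metric.isOpen_ball (fun q hq => (hb q hq).2.1)
  · exact ⟨(0, 0), Metric.mem_ball_self hρ, hG0⟩
  · rintro _ ⟨q, hq, rfl⟩
    exact hWV (hb q hq).2.2.1
  rw [hQ]
  refine ⟨fun q hq => (hGc q (hb q hq).1).contDiffWithinAt, ?_, ⟨P.symm, ?_, ?_⟩, hG0, ?_, ?_, ?_⟩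
  · exact (P.injOn.mono (fun q hq => (hb q hq).2.1)).bijOn_image
  · rintro _ ⟨q, hq, rfl⟩
    exact (hb q hq).2.2.2.contDiffWithinAt
  · intro q hq
    exact P.left_inv (hb q hq).2.1
  · intro q hq
    rw [hGr q (hb q hq).1, hRW _ (hb q hq).2.2.1]
  · intro q hq
    rw [hcomp q (hb q hq).1 (hb q hq).2.2.1, ContinuousLinearMap.comp_apply,
      hGr q (hb q hq).1, hRW _ (hb q hq).2.2.1]
    exact (heig _ (hWV (hb q hq).2.2.1)).2
  · rw [hcomp _ h0S (by rw [hG0]; exact husW), hG0, hGe]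
    rw [LinearMap.finrank_range_of_inj]
    · simp
    · rw [← LinearMap.ker_eq_bot, LinearMap.ker_eq_bot']
      intro z hz
      have hz' : -(lam us) • e (0, z) + fderiv ℝ f us (e (0, z)) = 0 := hz
      have hev1 := (heig us husV₀).2
      obtain ⟨c, hc⟩ := ker_of_simple (fderiv ℝ f us).toLinearMap lams hsimple (r us)
        (heig us husV₀).1 (by
          rw [← hlamus]; rw [neg_smul, neg_add_eq_zero] at hev1; exact hev1.symm) (e (0, z)) (by
          rw [← hlamus]; rw [neg_smul, neg_add_eq_zero] at hz'; exact hz'.symm)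
      rw [← he, ← map_smul] at hc
      have := e.injective hc
      simpa using congrArg Prod.snd this

end
end

section
/- Let v be a reduced state function that is a self-similar weak solution of u_t + f(u)_x = 0. Then there exist ξ_L, ξ_R ∈ ℝ and constants u_L, u_R ∈ ℝ^n such that v(ξ) = u_L for a.e. ξ ∈ (−∞, ξ_L) and v(ξ) = u_R for a.e. ξ ∈ (ξ_R, ∞). -/
open MeasureTheory Set Matrix

noncomputable section

lemma hcs_bound {φ : ℝ → ℝ} (hc : HasCompactSupport φ) :
    ∃ R > 0, ∀ x, R ≤ |x| → φ x = 0 := by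
  obtain ⟨R, hR, h⟩ := hc.exists_pos_le_norm
  exact ⟨R, hR, fun x hx => h x (by simpa using hx)⟩

lemma integral_eq_interval {h : ℝ → ℝ} {R : ℝ} (hh : ∀ x, R ≤ |x| → h x = 0) :
    ∫ x, h x = ∫ x in (-R)..R, h x := by
  symm
  apply intervalIntegral.integral_eq_integral_of_support_subset
  intro x hx
  have : ¬ R ≤ |x| := fun h' => hx (hh x h')
  rw [not_le, abs_lt] at this
  exact ⟨this.1, this.2.le⟩

lemma li_ii {v : ℝ → ℝ} (hv : LocallyIntegrable v) (a b : ℝ) :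
    IntervalIntegrable v volume a b :=
  intervalIntegrable_iff.2 ((hv.integrableOn_isCompact isCompact_uIcc).mono_set uIoc_subset_uIcc)

lemma parts_aux {v : ℝ → ℝ} (hv : LocallyIntegrable v) {φ : ℝ → ℝ} (hφ : ContDiff ℝ 1 φ)
    (hc : HasCompactSupport φ) :
    ∫ x, (deriv φ x * (∫ s in (0:ℝ)..x, v s) + φ x * v x) = 0 := by
  obtain ⟨R, hR, h⟩ := hcs_bound hc
  obtain ⟨R', hR', h'⟩ := hcs_bound hc.deriv
  set T := max R R' with hT
  have h1 : ∀ x, T ≤ |x| → φ x = 0 := fun x hx => h x ((le_max_left _ _).trans hx)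
  have h2 : ∀ x, T ≤ |x| → deriv φ x = 0 := fun x hx => h' x ((le_max_right _ _).trans hx)
  have hT0 : 0 < T := lt_max_of_lt_left hR
  rw [integral_eq_interval (R := T) (fun x hx => by rw [h1 x hx, h2 x hx]; simp)]
  have hVI : IntervalIntegrable v volume (-T) T := li_ii hv _ _
  have hV := hVI.absolutelyContinuousOnInterval_intervalIntegral (c := 0)
    (by rw [uIcc_of_le (by linarith)]; exact ⟨by linarith, hT0.le⟩)
  have hφ' : AbsolutelyContinuousOnInterval φ (-T) T :=
    hφ.contDiffOn.absolutelyContinuousOnInterval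
  have := hφ'.integral_deriv_mul_eq_sub hV
  rw [h1 T (le_abs_self _), h1 (-T) (by rw [abs_neg]; exact le_abs_self _)] at this
  simp only [zero_mul, sub_zero] at this
  refine Eq.trans ?_ this
  apply intervalIntegral.integral_congr_ae
  filter_upwards [LocallyIntegrable.ae_hasDerivAt_integral hv] with x hx _
  rw [(hx 0).deriv]

lemma exists_prim {h : ℝ → ℝ} (hh : Continuous h) (hc : HasCompactSupport h)
    (h0 : ∫ x, h x = 0) :
    ∃ φ : ℝ → ℝ, ContDiff ℝ 1 φ ∧ HasCompactSupport φ ∧ deriv φ = h := by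
  obtain ⟨R, hR, hz⟩ := hcs_bound hc
  have hd : ∀ x, HasDerivAt (fun x => ∫ s in (-R)..x, h s) (h x) x := fun x =>
    intervalIntegral.integral_hasDerivAt_right (hh.intervalIntegrable _ _)
      (hh.stronglyMeasurableAtFilter _ _) hh.continuousAt
  have hder : deriv (fun x => ∫ s in (-R)..x, h s) = h := funext fun x => (hd x).deriv
  refine ⟨fun x => ∫ s in (-R)..x, h s, ?_, ?_, hder⟩
  · rw [contDiff_one_iff_deriv, hder]
    exact ⟨fun x => (hd x).differentiableAt, hh⟩
  · refine HasCompactSupport.of_support_subset_isCompact (isCompact_Icc (a := -R) (b := R)) ?_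
    intro x hx
    by_contra hx'
    apply hx
    rw [integral_eq_interval hz] at h0
    rw [mem_Icc, not_and_or, not_le, not_le] at hx'
    rcases hx' with hx' | hx'
    · apply intervalIntegral.integral_zero_ae
      refine .of_forall fun s hs => hz s ?_
      rw [uIoc_of_ge hx'.le] at hs
      rw [le_abs]; right; linarith [hs.2]
    · show ∫ s in (-R)..x, h s = 0
      rw [← intervalIntegral.integral_add_adjacent_intervals (b := R)
        (hh.intervalIntegrable _ _) (hh.intervalIntegrable _ _), h0, zero_add]
      apply intervalIntegral.integral_zero_ae
      refine .of_forall fun s hs => hz s ?_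
      rw [uIoc_of_le hx'.le] at hs
      rw [le_abs]; left; linarith [hs.1]

lemma dbr {g v : ℝ → ℝ} (hg : LocallyIntegrable g) (hv : LocallyIntegrable v)
    (h : ∀ φ : ℝ → ℝ, ContDiff ℝ 1 φ → HasCompactSupport φ →
      ∫ x, (deriv φ x * g x - φ x * v x) = 0) :
    ∃ c : ℝ, ∀ᵐ x : ℝ, g x + (∫ s in (0:ℝ)..x, v s) = c := by
  have hVc : Continuous (fun x => ∫ s in (0:ℝ)..x, v s) :=
    intervalIntegral.continuous_primitive (fun a b => li_ii hv a b) 0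
  have hW : LocallyIntegrable (fun x => g x + (∫ s in (0:ℝ)..x, v s)) :=
    hg.add hVc.locallyIntegrable
  set W : ℝ → ℝ := (fun x => g x + (∫ s in (0:ℝ)..x, v s)) with hWd
  have key : ∀ φ : ℝ → ℝ, ContDiff ℝ 1 φ → HasCompactSupport φ → ∫ x, deriv φ x * W x = 0 := by
    intro φ hφ hc
    have e1 := h φ hφ hc
    have e2 := parts_aux hv hφ hc
    have hφ'c : Continuous (deriv φ) := hφ.continuous_deriv le_rfl
    have i1 : Integrable (fun x => deriv φ x * g x) := by
      simpa using hg.integrable_smul_left_of_hasCompactSupport hφ'c hc.deriv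
    have i2 : Integrable (fun x => φ x * v x) := by
      simpa using hv.integrable_smul_left_of_hasCompactSupport hφ.continuous hc
    have i3 : Integrable (fun x => deriv φ x * ∫ s in (0:ℝ)..x, v s) := by
      simpa using hVc.locallyIntegrable.integrable_smul_left_of_hasCompactSupport hφ'c hc.deriv
    have := integral_add (i1.sub i2) (i3.add i2)
    simp only [Pi.sub_apply, Pi.add_apply] at this
    rw [e1, e2, add_zero] at this
    rw [← this]
    congr 1; ext x; simp only [hWd]; ring
  obtain ⟨b⟩ : Nonempty (ContDiffBump (0:ℝ)) := ⟨⟨1, 2, one_pos, one_lt_two⟩⟩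
  set ρ : ℝ → ℝ := b.normed volume
  have hρc : Continuous ρ := b.continuous_normed
  have hρs : HasCompactSupport ρ := b.hasCompactSupport_normed
  have hρ1 : ∫ x, ρ x = 1 := b.integral_normed
  have hρi : Integrable ρ := hρc.integrable_of_hasCompactSupport hρs
  have hρW : Integrable (fun x => ρ x * W x) := by
    simpa using hW.integrable_smul_left_of_hasCompactSupport hρc hρs
  refine ⟨∫ x, ρ x * W x, ?_⟩
  set c := ∫ x, ρ x * W x with hcdef
  have := ae_eq_zero_of_integral_contDiff_smul_eq_zero (μ := volume) (f := fun x => W x - c)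
    (hW.sub (locallyIntegrable_const c)) ?_
  · filter_upwards [this] with x hx using sub_eq_zero.1 hx
  intro η hη hηs
  have hηc := hη.continuous
  have hηi : Integrable η := hηc.integrable_of_hasCompactSupport hηs
  have hηW : Integrable (fun x => η x * W x) := by
    simpa using hW.integrable_smul_left_of_hasCompactSupport hηc hηs
  have hss : HasCompactSupport (fun x => (∫ y, η y) * ρ x) := hρs.mul_left
  obtain ⟨φ, h1, h2, h3⟩ := exists_prim (h := fun x => η x - (∫ y, η y) * ρ x)
    (hηc.sub (continuous_const.mul hρc)) (hηs.sub hss)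
    (by rw [integral_sub hηi (hρi.const_mul _), integral_const_mul, hρ1]; ring)
  have k := key φ h1 h2
  rw [h3] at k
  have e : ∀ x, (η x - (∫ y, η y) * ρ x) * W x = η x * W x - (∫ y, η y) * (ρ x * W x) :=
    fun x => by ring
  simp_rw [e] at k
  rw [integral_sub hηW (hρW.const_mul _), integral_const_mul, ← hcdef] at k
  simp only [smul_eq_mul, mul_sub]
  rw [integral_sub hηW (hηi.mul_const _), integral_mul_const]
  exact k

lemma contract_core {n : ℕ} {v : ℝ → (Fin n → ℝ)} {f : (Fin n → ℝ) → (Fin n → ℝ)}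
    {G : Set ℝ} (hG : ∀ᵐ x : ℝ, x ∈ G) {L C : ℝ} (hL0 : 0 ≤ L)
    (hvi : ∀ i, LocallyIntegrable (fun x => v x i)) (c : Fin n → ℝ)
    (hid : ∀ x ∈ G, ∀ i, (-x * v x i + f (v x) i) + (∫ s in (0:ℝ)..x, v s i) = c i)
    (hL : ∀ x ∈ G, ∀ y ∈ G, ‖f (v x) - f (v y)‖ ≤ L * ‖v x - v y‖)
    (hC : ∀ x ∈ G, ‖v x‖ ≤ C)
    {a b q : ℝ} (ha : a ∈ G) (hb : b ∈ G) (hq0 : 0 ≤ q) (hq1 : q < 1)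
    (hS : ∀ x ∈ uIcc a b, 0 < |x| ∧ |x - a| ≤ q * (|x| - L) ∧ L < |x|) : v b = v a := by
  have key : ∀ k : ℕ, ∀ x ∈ uIcc a b, x ∈ G → ‖v x - v a‖ ≤ q ^ k * (2 * C) := by
    intro k
    induction k with
    | zero =>
      intro x _ hxG
      have := norm_sub_le (v x) (v a)
      have := hC x hxG
      have := hC a ha
      simp; linarith
    | succ k ih =>
      intro x hx hxG
      obtain ⟨hx0, hxq, hxL⟩ := hS x hx
      set M := q ^ k * (2 * C) with hM
      have hM0 : 0 ≤ M := (norm_nonneg _).trans (ih x hx hxG)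
      have hco : ∀ i, |x| * |v x i - v a i| ≤ L * ‖v x - v a‖ + M * |x - a| := by
        intro i
        have e1 := hid x hxG i
        have e2 := hid a ha i
        have e3 : (∫ s in (0:ℝ)..x, v s i) - (∫ s in (0:ℝ)..a, v s i) = ∫ s in a..x, v s i :=
          intervalIntegral.integral_interval_sub_left (li_ii (hvi i) _ _) (li_ii (hvi i) _ _)
        have e4 : ∫ s in a..x, (v s i - v a i) = (∫ s in a..x, v s i) - (x - a) * v a i := by
          rw [intervalIntegral.integral_sub (li_ii (hvi i) _ _) (by simp)]
          simp
        have e5 : x * (v x i - v a i) = (f (v x) - f (v a)) i + ∫ s in a..x, (v s i - v a i) := by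
          rw [e4, ← e3, Pi.sub_apply]; linarith
        have e6 : ‖∫ s in a..x, (v s i - v a i)‖ ≤ M * |x - a| := by
          apply intervalIntegral.norm_integral_le_of_norm_le_const_ae
          filter_upwards [hG] with s hs hsI
          refine (norm_le_pi_norm (v s - v a) i).trans (ih s ?_ hs)
          exact uIcc_subset_uIcc_left hx (uIoc_subset_uIcc hsI)
        have e7 := norm_le_pi_norm (f (v x) - f (v a)) i
        have e8 := hL x hxG a ha
        rw [← abs_mul, e5]
        refine (abs_add_le _ _).trans ?_
        rw [Real.norm_eq_abs] at e6 e7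
        linarith
      have hn : ‖v x - v a‖ ≤ (L * ‖v x - v a‖ + M * |x - a|) / |x| := by
        have h0 : 0 ≤ L * ‖v x - v a‖ + M * |x - a| := by
          positivity
        rw [pi_norm_le_iff_of_nonneg (by positivity)]
        intro i
        rw [le_div_iff₀ hx0, mul_comm]
        exact hco i
      rw [le_div_iff₀ hx0] at hn
      have h1 : (|x| - L) * ‖v x - v a‖ ≤ (|x| - L) * (q * M) := by
        have := mul_le_mul_of_nonneg_left hxq hM0
        nlinarith
      have h2 := le_of_mul_le_mul_left h1 (by linarith)
      rw [pow_succ]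
      calc _ ≤ _ := h2
        _ = _ := by rw [hM]; ring
  have hlim : Filter.Tendsto (fun k : ℕ => q ^ k * (2 * C)) Filter.atTop (nhds 0) := by
    simpa using (tendsto_pow_atTop_nhds_zero_of_lt_one hq0 hq1).mul_const (2 * C)
  have h0 : ‖v b - v a‖ ≤ 0 := ge_of_tendsto' hlim fun k => key k b right_mem_uIcc hb
  exact sub_eq_zero.1 (norm_le_zero_iff.1 h0)

/-- A self-similar weak solution is essentially constant near `−∞`
and near `+∞`. -/
theorem essentially_constant_at_infinity
    {n : ℕ} (U : Set (Fin n → ℝ)) (hU : IsOpen U)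
    (f : (Fin n → ℝ) → (Fin n → ℝ)) (hf : ContDiffOn ℝ 2 f U)
    (hconv : convexHull ℝ (USH f U) ⊆ U)
    (v : ℝ → (Fin n → ℝ)) (hv : IsReducedState f U v)
    (hsol : IsSSWeakSol f v) :
    ∃ (ξL ξR : ℝ) (uL uR : Fin n → ℝ),
      (∀ᵐ ξ : ℝ ∂volume, ξ < ξL → v ξ = uL) ∧
      (∀ᵐ ξ : ℝ ∂volume, ξR < ξ → v ξ = uR) := by
  obtain ⟨hvm, ⟨C, hC⟩, hess⟩ := hv
  set K : Set (Fin n → ℝ) := (volume.map v).support with hK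
  have hKU : K ⊆ U := by
    intro z hz
    refine (hess ?_).1
    intro V hV hzV
    rw [hK, Measure.support_eq_forall_isOpen] at hz
    have := hz V hzV hV
    rwa [Measure.map_apply hvm hV.measurableSet, ← inter_univ (v ⁻¹' V)] at this
  have hvK : ∀ᵐ ξ : ℝ, v ξ ∈ K := by
    have : ∀ᵐ z ∂(volume.map v), z ∈ K := Measure.support_mem_ae
    exact ae_of_ae_map hvm.aemeasurable this
  have hKcl : IsClosed K := Measure.isClosed_support
  have hKb : ∀ z ∈ K, ‖z‖ ≤ C := by
    intro z hz
    by_contra hzC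
    rw [hK, Measure.support_eq_forall_isOpen] at hz
    have hV : IsOpen {z : Fin n → ℝ | C < ‖z‖} := isOpen_lt continuous_const continuous_norm
    have := hz {z : Fin n → ℝ | C < ‖z‖} (show C < ‖z‖ from not_le.1 hzC) hV
    rw [Measure.map_apply hvm hV.measurableSet] at this
    apply this.ne'
    rw [ae_iff] at hC
    simpa using hC
  have hKc : IsCompact K := by
    refine Metric.isCompact_of_isClosed_isBounded hKcl ?_
    exact isBounded_iff_forall_norm_le.2 ⟨C, hKb⟩
  have hlip : LocallyLipschitzOn K f := by
    intro x hx
    have hcd : ContDiffAt ℝ 1 f x := (hf.contDiffAt (hU.mem_nhds (hKU hx))).of_le (by norm_num)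
    obtain ⟨k, t, ht, hkt⟩ := hcd.exists_lipschitzOnWith
    exact ⟨k, t, mem_nhdsWithin_of_mem_nhds ht, hkt⟩
  obtain ⟨L, hL⟩ := hlip.exists_lipschitzOnWith_of_compact hKc
  have hfc : ContinuousOn f K := hL.continuousOn
  obtain ⟨D, hD⟩ := hKc.exists_bound_of_continuousOn hfc
  have hfv : AEMeasurable (fun ξ => f (v ξ)) := by
    classical
    refine ⟨fun ξ => K.piecewise f (fun _ => 0) (v ξ), ?_, ?_⟩
    · exact (hfc.measurable_piecewise continuousOn_const hKcl.measurableSet).comp hvm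
    · filter_upwards [hvK] with ξ hξ
      simp [hξ]
  have hvi : ∀ i, LocallyIntegrable (fun x => v x i) := by
    intro i
    have : MemLp (fun x => v x i) ⊤ := by
      refine memLp_top_of_bound ((measurable_pi_apply i).comp hvm).aestronglyMeasurable C ?_
      filter_upwards [hC] with x hx using (norm_le_pi_norm (v x) i).trans hx
    exact this.locallyIntegrable le_top
  have hfi : ∀ i, LocallyIntegrable (fun x => f (v x) i) := by
    intro i
    have : MemLp (fun x => f (v x) i) ⊤ := by
      refine memLp_top_of_bound ((measurable_pi_apply i).comp_aemeasurable hfv).aestronglyMeasurable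
        D ?_
      filter_upwards [hvK] with x hx using (norm_le_pi_norm (f (v x)) i).trans (hD _ hx)
    exact this.locallyIntegrable le_top
  have hgi : ∀ i, LocallyIntegrable (fun x => -x * v x i + f (v x) i) := by
    intro i
    refine LocallyIntegrable.add ?_ (hfi i)
    rw [← locallyIntegrableOn_univ]
    exact ((locallyIntegrableOn_univ.2 (hvi i)).continuousOn_mul
      continuous_neg.continuousOn isOpen_univ.isLocallyClosed)
  have hdbr : ∀ i, ∃ c : ℝ, ∀ᵐ x : ℝ,
      (-x * v x i + f (v x) i) + (∫ s in (0:ℝ)..x, v s i) = c := by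
    intro i
    refine dbr (hgi i) (hvi i) ?_
    intro φ hφ hc
    have hd : ∀ x, deriv (fun y => Pi.single (M := fun _ : Fin n => ℝ) i (φ y)) x
        = Pi.single i (deriv φ x) := by
      intro x
      have h1 := (hφ.differentiable (by norm_num) x).hasDerivAt
      refine HasDerivAt.deriv ?_
      rw [hasDerivAt_pi]
      intro j
      by_cases hj : j = i
      · subst hj; simpa using h1
      · simpa [hj] using hasDerivAt_const x (0:ℝ)
    have := hsol (fun y => Pi.single i (φ y)) ?_ ?_
    · rw [← this]
      congr 1; ext x
      simp [hd]
      try ring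
    · rw [contDiff_pi]
      intro j
      by_cases hj : j = i
      · subst hj; simpa using hφ
      · simpa [hj] using contDiff_const
    · exact hc.comp_left (g := fun t : ℝ => Pi.single (M := fun _ : Fin n => ℝ) i t) (by simp)
  choose c hc using hdbr
  set G : Set ℝ := {x | v x ∈ K ∧ ∀ i,
    (-x * v x i + f (v x) i) + (∫ s in (0:ℝ)..x, v s i) = c i} with hGdef
  have hG : ∀ᵐ x : ℝ, x ∈ G := by
    filter_upwards [hvK, ae_all_iff.2 hc] with x h1 h2 using ⟨h1, h2⟩
  have hL0 : (0:ℝ) ≤ L := L.2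
  have hcore : ∀ a ∈ G, ∀ b ∈ G, ∀ q : ℝ, 0 ≤ q → q < 1 →
      (∀ x ∈ uIcc a b, 0 < |x| ∧ |x - a| ≤ q * (|x| - L) ∧ (L:ℝ) < |x|) → v b = v a := by
    intro a ha b hb q hq0 hq1 hS
    refine contract_core hG hL0 hvi c (fun x hx => hx.2) ?_ (fun x hx => hKb _ hx.1) ha hb
      hq0 hq1 hS
    intro x hx y hy
    simpa [dist_eq_norm] using hL.dist_le_mul _ hx.1 _ hy.1
  obtain ⟨a, haL, haG⟩ := Measure.exists_mem_of_measure_ne_zero_of_ae (μ := volume)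
    (s := Ioi (L:ℝ)) (by simp) (ae_restrict_of_ae hG)
  obtain ⟨a', haL', haG'⟩ := Measure.exists_mem_of_measure_ne_zero_of_ae (μ := volume)
    (s := Iio (-L:ℝ)) (by simp) (ae_restrict_of_ae hG)
  simp only [mem_Ioi, mem_Iio] at haL haL'
  refine ⟨a', a, v a', v a, ?_, ?_⟩
  · filter_upwards [hG] with b hb hab
    have hpos : 0 < -b - L := by linarith
    refine hcore a' haG' b hb ((a' - b) / (-b - L)) (div_nonneg (by linarith) hpos.le)
      ((div_lt_one hpos).2 (by linarith)) ?_
    intro x hx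
    rw [uIcc_of_ge hab.le] at hx
    have hx0 : x < 0 := by linarith [hx.2]
    rw [abs_of_neg hx0, abs_of_nonpos (by linarith [hx.2])]
    refine ⟨by linarith, ?_, by linarith [hx.2]⟩
    rw [div_mul_eq_mul_div, le_div_iff₀ hpos]
    nlinarith [hx.1, hx.2, mul_nonneg (sub_nonneg.2 hx.1) (by linarith : 0 ≤ -a' - L)]
  · filter_upwards [hG] with b hb hab
    have hpos : 0 < b - L := by linarith
    refine hcore a haG b hb ((b - a) / (b - L)) (div_nonneg (by linarith) hpos.le)
      ((div_lt_one hpos).2 (by linarith)) ?_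
    intro x hx
    rw [uIcc_of_le hab.le] at hx
    have hx0 : 0 < x := by linarith [hx.1]
    rw [abs_of_pos hx0, abs_of_nonneg (by linarith [hx.1])]
    refine ⟨by linarith, ?_, by linarith [hx.1]⟩
    rw [div_mul_eq_mul_div, le_div_iff₀ hpos]
    nlinarith [hx.1, hx.2, mul_nonneg (sub_nonneg.2 hx.2) (by linarith : 0 ≤ a - L)]

end
end

section
/- Let v be a reduced state function that is a self-similar weak solution of u_t + f(u)_x = 0. Define S as the set of ess-im discontinuity points of v, C as the set of ess-im continuity points ξ with det(−ξ I + A(v̄(ξ))) ≠ 0, and W as the set of ess-im continuity points ξ with det(−ξ I + A(v̄(ξ))) = 0, where v̄(ξ) denotes the ess-im accumulation value of v at an ess-im continuity point ξ. Then the set S ∪ W is closed in ℝ and the set C is open in ℝ. -/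
open MeasureTheory Set Matrix

noncomputable section

open Filter Topology

theorem dbr_aux (a b : ℝ) (hab : a < b) (g w : ℝ → ℝ)
    (hg : IntervalIntegrable g volume a b) (hw : IntervalIntegrable w volume a b)
    (H : ∀ ψ : ℝ → ℝ, ContDiff ℝ 1 ψ → HasCompactSupport ψ → tsupport ψ ⊆ Ioo a b →
      ∫ ξ in a..b, (deriv ψ ξ * g ξ - ψ ξ * w ξ) = 0) :
    ∃ c : ℝ, ∀ᵐ ξ : ℝ, ξ ∈ Ioo a b → g ξ = c - ∫ t in a..ξ, w t := by
  set W : ℝ → ℝ := fun x => ∫ t in a..x, w t with hW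
  have hWac : AbsolutelyContinuousOnInterval W a b :=
    hw.absolutelyContinuousOnInterval_intervalIntegral (by simp)
  have hWd : ∀ᵐ x, x ∈ uIcc a b → deriv W x = w x := by
    filter_upwards [hw.ae_hasDerivAt_integral] with x hx hxab
    exact (hx hxab a (by simp)).deriv
  set G : ℝ → ℝ := fun x => g x + W x with hG
  have hWi : IntervalIntegrable W volume a b := hWac.continuousOn.intervalIntegrable
  have hGi : IntervalIntegrable G volume a b := hg.add hWi
  have key : ∀ ψ : ℝ → ℝ, ContDiff ℝ 1 ψ → HasCompactSupport ψ → tsupport ψ ⊆ Ioo a b →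
      ∫ ξ in a..b, deriv ψ ξ * G ξ = 0 := by
    intro ψ h1 h2 h3
    have hψa : ψ a = 0 := image_eq_zero_of_notMem_tsupport (fun h => lt_irrefl _ (h3 h).1)
    have hψb : ψ b = 0 := image_eq_zero_of_notMem_tsupport (fun h => lt_irrefl _ (h3 h).2)
    have hψac : AbsolutelyContinuousOnInterval ψ a b :=
      h1.contDiffOn.absolutelyContinuousOnInterval
    have ibp := hψac.integral_mul_deriv_eq_deriv_mul hWac
    have e1 : ∫ x in a..b, ψ x * deriv W x = ∫ x in a..b, ψ x * w x := by
      apply intervalIntegral.integral_congr_ae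
      filter_upwards [hWd] with x hx hxab
      rw [hx (uIoc_subset_uIcc hxab)]
    have hd : Continuous (deriv ψ) := h1.continuous_deriv le_rfl
    have i1 : IntervalIntegrable (fun x => deriv ψ x * g x) volume a b :=
      hg.continuousOn_mul hd.continuousOn
    have i2 : IntervalIntegrable (fun x => ψ x * w x) volume a b :=
      hw.continuousOn_mul h1.continuous.continuousOn
    have i3 : IntervalIntegrable (fun x => deriv ψ x * W x) volume a b :=
      hWi.continuousOn_mul hd.continuousOn
    have h0 := H ψ h1 h2 h3
    rw [intervalIntegral.integral_sub i1 i2] at h0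
    have : ∫ ξ in a..b, deriv ψ ξ * G ξ =
        (∫ ξ in a..b, deriv ψ ξ * g ξ) + ∫ ξ in a..b, deriv ψ ξ * W ξ := by
      rw [← intervalIntegral.integral_add i1 i3]
      simp only [hG, mul_add]
    rw [e1, hψa, hψb] at ibp
    rw [this]; linarith
  let B : ContDiffBump ((a + b) / 2) := ⟨(b - a) / 8, (b - a) / 4, by linarith, by linarith⟩
  set φ0 : ℝ → ℝ := B.normed volume with hφ0
  have hφ0s : ContDiff ℝ 1 φ0 := B.contDiff_normed
  have hφ0c : HasCompactSupport φ0 := B.hasCompactSupport_normed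
  have hφ0i : ∫ x, φ0 x = 1 := B.integral_normed
  have hφ0t : tsupport φ0 ⊆ Ioo a b := by
    rw [hφ0, B.tsupport_normed_eq, Real.closedBall_eq_Icc]
    intro x hx
    have h1 : (a + b) / 2 - (b - a) / 4 ≤ x := hx.1
    have h2 : x ≤ (a + b) / 2 + (b - a) / 4 := hx.2
    constructor <;> linarith
  have hφ0ne : (tsupport φ0).Nonempty := by
    rw [hφ0, B.tsupport_normed_eq]
    exact Metric.nonempty_closedBall.2 B.rOut_pos.le
  set c : ℝ := ∫ x in a..b, φ0 x * G x with hc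
  have fin : ∀ᵐ x : ℝ, x ∈ Ioo a b → G x - c = 0 := by
    have hli : IntegrableOn (fun x => G x - c) (Ioo a b) := by
      have := (hGi.sub (intervalIntegrable_const (c := c))).1
      exact this.mono_set Ioo_subset_Ioc_self
    apply isOpen_Ioo.ae_eq_zero_of_integral_contDiff_smul_eq_zero hli.locallyIntegrableOn
    intro φ hφs hφc hφt
    have hφs1 : ContDiff ℝ 1 φ := hφs.of_le (by exact_mod_cast le_top)
    set m : ℝ := ∫ x, φ x with hm
    set h : ℝ → ℝ := fun x => φ x - m * φ0 x with hh
    have hhc : Continuous h := by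
      have := hφs1.continuous
      have := hφ0s.continuous
      fun_prop
    have hK : IsCompact (tsupport φ ∪ tsupport φ0) := hφc.isCompact.union hφ0c.isCompact
    have hKs : tsupport φ ∪ tsupport φ0 ⊆ Ioo a b := union_subset hφt hφ0t
    obtain ⟨p, hp, hpl⟩ := hK.exists_isLeast (hφ0ne.inr)
    obtain ⟨q, hq, hql⟩ := hK.exists_isGreatest (hφ0ne.inr)
    have hz : ∀ x, x ∉ Icc p q → h x = 0 := by
      intro x hx
      have hx' : x ∉ tsupport φ ∪ tsupport φ0 := fun hx' => hx ⟨hpl hx', hql hx'⟩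
      have h1 : φ x = 0 := image_eq_zero_of_notMem_tsupport (fun h => hx' (Or.inl h))
      have h2 : φ0 x = 0 := image_eq_zero_of_notMem_tsupport (fun h => hx' (Or.inr h))
      simp [hh, h1, h2]
    have hφI : Integrable φ := hφs1.continuous.integrable_of_hasCompactSupport hφc
    have hφ0I : Integrable φ0 := hφ0s.continuous.integrable_of_hasCompactSupport hφ0c
    have hint : ∫ x, h x = 0 := by
      rw [hh, integral_sub hφI (hφ0I.const_mul m), integral_const_mul, hφ0i]
      simp [hm]
    set ψ : ℝ → ℝ := fun x => ∫ t in a..x, h t with hψ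
    have hψd : ∀ x, HasDerivAt ψ (h x) x := fun x =>
      intervalIntegral.integral_hasDerivAt_right (hhc.intervalIntegrable _ _)
        hhc.stronglyMeasurable.stronglyMeasurableAtFilter hhc.continuousAt
    have hψd' : deriv ψ = h := funext fun x => (hψd x).deriv
    have hψs : ContDiff ℝ 1 ψ := by
      rw [contDiff_one_iff_deriv]
      exact ⟨fun x => (hψd x).differentiableAt, hψd' ▸ hhc⟩
    have hψz : ∀ x, x ∉ Icc p q → ψ x = 0 := by
      intro x hx
      rw [mem_Icc, not_and_or, not_le, not_le] at hx
      rcases hx with hx | hx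
      · apply intervalIntegral.integral_zero_ae
        refine Eventually.of_forall fun t ht => hz t fun ht' => ?_
        have h1 : t ≤ max a x := ht.2
        have h2 : max a x < p := max_lt (hKs hp).1 hx
        linarith [ht'.1]
      · have : Function.support h ⊆ Ioc a x := by
          intro t ht
          have ht' : t ∈ Icc p q := by
            by_contra hcon
            exact ht (hz t hcon)
          exact ⟨(hKs hp).1.trans_le ht'.1, ht'.2.trans hx.le⟩
        rw [hψ]
        simp only
        rw [intervalIntegral.integral_eq_integral_of_support_subset this, hint]
    have hψsup : tsupport ψ ⊆ Icc p q := by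
      apply closure_minimal _ isClosed_Icc
      intro x hx
      by_contra hcon
      exact hx (hψz x hcon)
    have hψc : HasCompactSupport ψ := isCompact_Icc.of_isClosed_subset (isClosed_tsupport _) hψsup
    have hψt : tsupport ψ ⊆ Ioo a b := hψsup.trans fun x hx =>
      ⟨(hKs hp).1.trans_le hx.1, hx.2.trans_lt (hKs hq).2⟩
    have k := key ψ hψs hψc hψt
    rw [hψd'] at k
    have j1 : IntervalIntegrable (fun x => φ x * G x) volume a b :=
      hGi.continuousOn_mul hφs1.continuous.continuousOn
    have j2 : IntervalIntegrable (fun x => φ0 x * G x) volume a b :=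
      hGi.continuousOn_mul hφ0s.continuous.continuousOn
    have j3 : ∫ x in a..b, h x * G x = (∫ x in a..b, φ x * G x) - m * c := by
      rw [hc, ← intervalIntegral.integral_const_mul, ← intervalIntegral.integral_sub j1
        (j2.const_mul m)]
      congr 1; ext x; simp only [hh]; ring
    have sub : ∀ F : ℝ → ℝ, Function.support (fun x => φ x * F x) ⊆ Ioc a b := by
      intro F x hx
      have hx1 : φ x ≠ 0 := fun h0 => hx (by simp [h0])
      exact Ioo_subset_Ioc_self (hφt (subset_tsupport _ hx1))
    have j4 : ∫ x in a..b, φ x * 1 = m := by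
      rw [intervalIntegral.integral_eq_integral_of_support_subset (sub fun _ => 1)]
      simp [hm]
    simp only [smul_eq_mul]
    rw [← intervalIntegral.integral_eq_integral_of_support_subset (sub fun x => G x - c)]
    have j5 : ∫ x in a..b, φ x * (G x - c) = (∫ x in a..b, φ x * G x) -
        c * ∫ x in a..b, φ x * 1 := by
      rw [← intervalIntegral.integral_const_mul, ← intervalIntegral.integral_sub j1]
      · congr 1; ext x; ring
      · exact Continuous.intervalIntegrable (by have := hφs1.continuous; fun_prop) _ _
    rw [j5, j4]
    linarith
  refine ⟨c, ?_⟩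
  filter_upwards [fin] with x hx hxab
  have := hx hxab
  simp only [hG] at this
  linarith

theorem left_ae_near {n : ℕ} (v : ℝ → (Fin n → ℝ)) (C : ℝ) (hC : ∀ᵐ ξ : ℝ, ‖v ξ‖ ≤ C)
    (J : ℝ → Set ℝ) (hJ : ∀ r s, r ≤ s → J r ⊆ J s) (z : Fin n → ℝ)
    (hz : (⋂ r > (0:ℝ), essimOn v (J r)) = {z}) (ε : ℝ) (hε : 0 < ε) :
    ∃ r > 0, ∀ᵐ ξ : ℝ, ξ ∈ J r → v ξ ∈ Metric.ball z ε := by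
  have hK : IsCompact (Metric.closedBall (0 : Fin n → ℝ) C \ Metric.ball z ε) :=
    (isCompact_closedBall _ _).diff Metric.isOpen_ball
  have : ∃ r > 0, volume (v ⁻¹' (Metric.closedBall (0 : Fin n → ℝ) C \ Metric.ball z ε) ∩ J r)
      = 0 := by
    refine hK.induction_on (p := fun s => ∃ r > 0, volume (v ⁻¹' s ∩ J r) = 0) ?_ ?_ ?_ ?_
    · exact ⟨1, one_pos, by simp⟩
    · rintro s t hst ⟨r, hr, h⟩
      exact ⟨r, hr, measure_mono_null (inter_subset_inter_left _ (preimage_mono hst)) h⟩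
    · rintro s t ⟨r, hr, h⟩ ⟨r', hr', h'⟩
      refine ⟨min r r', lt_min hr hr', ?_⟩
      rw [preimage_union, union_inter_distrib_right]
      refine measure_union_null ?_ ?_
      · exact measure_mono_null (inter_subset_inter_right _ (hJ _ _ (min_le_left _ _))) h
      · exact measure_mono_null (inter_subset_inter_right _ (hJ _ _ (min_le_right _ _))) h'
    · intro y hy
      have hne : y ∉ (⋂ r > (0:ℝ), essimOn v (J r)) := by
        rw [hz]
        rintro rfl
        exact hy.2 (Metric.mem_ball_self hε)
      simp only [mem_iInter, essimOn, mem_setOf_eq, not_forall, not_lt, nonpos_iff_eq_zero] at hne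
      obtain ⟨r, hr, V, hV, hyV, h0⟩ := hne
      exact ⟨V, mem_nhdsWithin_of_mem_nhds (hV.mem_nhds hyV), r, hr, h0⟩
  obtain ⟨r, hr, h⟩ := this
  refine ⟨r, hr, ?_⟩
  have h' := measure_eq_zero_iff_ae_notMem.1 h
  filter_upwards [h', hC] with x hx hxC hxJ
  by_contra hcon
  exact hx ⟨⟨by simpa using hxC, hcon⟩, hxJ⟩

theorem acc_eq_of_cont {n : ℕ} (v w : ℝ → (Fin n → ℝ)) (hw : Continuous w) (a b : ℝ)
    (h : ∀ᵐ x : ℝ, x ∈ Ioo a b → v x = w x) (ξ : ℝ) (hξ : ξ ∈ Ioo a b)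
    (J : ℝ → Set ℝ) (hJs : ∀ r, J r ⊆ Ioo (ξ - r) (ξ + r))
    (hJ : ∀ r > 0, ∀ s > 0, 0 < volume (J r ∩ Ioo (ξ - s) (ξ + s))) :
    (⋂ r > (0:ℝ), essimOn v (J r)) = {w ξ} := by
  obtain ⟨δ, hδ, hδs⟩ : ∃ δ > 0, Ioo (ξ - δ) (ξ + δ) ⊆ Ioo a b := by
    obtain ⟨δ, hδ, h⟩ := Metric.isOpen_iff.1 isOpen_Ioo ξ hξ
    exact ⟨δ, hδ, by rwa [Real.ball_eq_Ioo] at h⟩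
  have near : ∀ V : Set (Fin n → ℝ), IsOpen V → w ξ ∈ V → ∃ s > 0,
      ∀ᵐ x : ℝ, x ∈ Ioo (ξ - s) (ξ + s) → v x ∈ V := by
    intro V hV hm
    obtain ⟨s, hs, hsV⟩ := Metric.isOpen_iff.1 (hV.preimage hw) ξ hm
    rw [Real.ball_eq_Ioo] at hsV
    refine ⟨min s δ, lt_min hs hδ, ?_⟩
    filter_upwards [h] with x hx hxI
    have l1 := min_le_left s δ
    have l2 := min_le_right s δ
    rw [hx (hδs ⟨by linarith [hxI.1], by linarith [hxI.2]⟩)]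
    exact hsV ⟨by linarith [hxI.1], by linarith [hxI.2]⟩
  ext y
  simp only [mem_iInter, mem_singleton_iff]
  constructor
  · intro hy
    by_contra hne
    obtain ⟨V, V', hV, hV', hyV, hwV, hd⟩ := t2_separation hne
    obtain ⟨s, hs, hsa⟩ := near V' hV' hwV
    have hp := hy s hs V hV hyV
    refine hp.ne' (measure_eq_zero_iff_ae_notMem.2 ?_)
    filter_upwards [hsa] with x hx hxm
    exact disjoint_left.1 hd hxm.1 (hx (hJs s hxm.2))
  · rintro rfl r hr V hV hm
    obtain ⟨s, hs, hsa⟩ := near V hV hm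
    refine (hJ r hr s hs).trans_le (measure_mono_ae ?_)
    filter_upwards [hsa] with x hx hxm
    exact ⟨hx hxm.2, hxm.1⟩

theorem accL_eq {n : ℕ} (v w : ℝ → (Fin n → ℝ)) (hw : Continuous w) (a b : ℝ)
    (h : ∀ᵐ x : ℝ, x ∈ Ioo a b → v x = w x) (ξ : ℝ) (hξ : ξ ∈ Ioo a b) :
    AessL v ξ = {w ξ} ∧ AessR v ξ = {w ξ} := by
  constructor
  · refine acc_eq_of_cont v w hw a b h ξ hξ (fun r => Ioo (ξ - r) ξ) ?_ ?_
    · intro r x hx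
      exact ⟨hx.1, by linarith [hx.1, hx.2]⟩
    · intro r hr s hs
      rw [Ioo_inter_Ioo, Real.volume_Ioo, ENNReal.ofReal_pos, sub_pos]
      exact max_lt (lt_min (by linarith) (by linarith)) (lt_min (by linarith) (by linarith))
  · refine acc_eq_of_cont v w hw a b h ξ hξ (fun r => Ioo ξ (ξ + r)) ?_ ?_
    · intro r x hx
      exact ⟨by linarith [hx.1, hx.2], hx.2⟩
    · intro r hr s hs
      rw [Ioo_inter_Ioo, Real.volume_Ioo, ENNReal.ofReal_pos, sub_pos]
      exact max_lt (lt_min (by linarith) (by linarith)) (lt_min (by linarith) (by linarith))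

theorem lower_bound {n : ℕ} (f : (Fin n → ℝ) → (Fin n → ℝ)) (ξ : ℝ) (z : Fin n → ℝ)
    (hf : HasStrictFDerivAt f (fderiv ℝ f z) z) (hd : detShift f ξ z ≠ 0) :
    ∃ κ > 0, ∃ ε > 0, ∀ u ∈ Metric.ball z ε, ∀ w ∈ Metric.ball z ε,
      κ * ‖u - w‖ ≤ ‖f u - f w - ξ • (u - w)‖ := by
  set L : (Fin n → ℝ) →ₗ[ℝ] (Fin n → ℝ) :=
    (-(ξ • (LinearMap.id : (Fin n → ℝ) →ₗ[ℝ] (Fin n → ℝ))) + (fderiv ℝ f z).toLinearMap) with hL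
  have hker : LinearMap.ker L = ⊥ := by
    by_contra hcon
    exact hd (LinearMap.det_eq_zero_iff_ker_ne_bot.2 hcon)
  obtain ⟨K, hK, hanti⟩ := LinearMap.exists_antilipschitzWith L hker
  have hK' : (0:ℝ) < K := hK
  have hlit := hf.isLittleO.def (c := (2 * (K:ℝ))⁻¹) (by positivity)
  rw [nhds_prod_eq, Filter.Eventually, mem_prod_same_iff] at hlit
  obtain ⟨s, hs, hss⟩ := hlit
  obtain ⟨ε, hε, hεs⟩ := Metric.mem_nhds_iff.1 hs
  refine ⟨(2 * (K:ℝ))⁻¹, by positivity, ε, hε, fun u hu w hw => ?_⟩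
  have h1 : ‖f u - f w - fderiv ℝ f z (u - w)‖ ≤ (2 * (K:ℝ))⁻¹ * ‖u - w‖ :=
    hss (mk_mem_prod (hεs hu) (hεs hw))
  have h2 : ‖u - w‖ ≤ K * ‖L (u - w)‖ := by
    have := hanti.le_mul_dist u w
    rwa [dist_eq_norm, dist_eq_norm, ← map_sub] at this
  have h3 : L (u - w) = (f u - f w - ξ • (u - w)) - (f u - f w - fderiv ℝ f z (u - w)) := by
    simp only [hL, LinearMap.add_apply, LinearMap.neg_apply, LinearMap.smul_apply,
      LinearMap.id_apply, ContinuousLinearMap.coe_coe]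
    abel
  have h4 : ‖L (u - w)‖ ≤ ‖f u - f w - ξ • (u - w)‖ + (2 * (K:ℝ))⁻¹ * ‖u - w‖ := by
    rw [h3]
    exact (norm_sub_le _ _).trans (by gcongr)
  have h5 : (K:ℝ)⁻¹ * ‖u - w‖ ≤ ‖L (u - w)‖ := by
    rw [inv_mul_le_iff₀ hK']; exact h2
  have h6 : (K:ℝ)⁻¹ = (2 * (K:ℝ))⁻¹ + (2 * (K:ℝ))⁻¹ := by field_simp; norm_num
  rw [h6, add_mul] at h5
  linarith

theorem local_cont {n : ℕ} (f : (Fin n → ℝ) → (Fin n → ℝ)) (U : Set (Fin n → ℝ)) (hU : IsOpen U)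
    (hf : ContDiffOn ℝ 2 f U) (v : ℝ → (Fin n → ℝ)) (hvm : Measurable v)
    (C : ℝ) (hC : ∀ᵐ ξ : ℝ, ‖v ξ‖ ≤ C) (hsol : IsSSWeakSol f v)
    (ξ₀ : ℝ) (z : Fin n → ℝ) (hzU : z ∈ U) (hL : AessL v ξ₀ = {z}) (hR : AessR v ξ₀ = {z})
    (hd : detShift f ξ₀ z ≠ 0) :
    ∃ w : ℝ → (Fin n → ℝ), Continuous w ∧ ∃ r > 0,
      ∀ᵐ x : ℝ, x ∈ Ioo (ξ₀ - r) (ξ₀ + r) → v x = w x := by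
  have hstrict : HasStrictFDerivAt f (fderiv ℝ f z) z :=
    ((hf.contDiffAt (hU.mem_nhds hzU)).hasStrictFDerivAt (by norm_num))
  obtain ⟨κ, hκ, ε₁, hε₁, hlow⟩ := lower_bound f ξ₀ z hstrict hd
  obtain ⟨ε₂, hε₂, hball⟩ := Metric.nhds_basis_closedBall.mem_iff.1 (hU.mem_nhds hzU)
  set ε := min ε₁ ε₂ with hε
  have hεpos : 0 < ε := lt_min hε₁ hε₂
  have hb1 : Metric.ball z ε ⊆ Metric.ball z ε₁ := Metric.ball_subset_ball (min_le_left _ _)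
  have hb2 : Metric.ball z ε ⊆ Metric.closedBall z ε₂ :=
    (Metric.ball_subset_ball (min_le_right _ _)).trans Metric.ball_subset_closedBall
  have hfc : ContinuousOn f (Metric.closedBall z ε₂) := hf.continuousOn.mono hball
  obtain ⟨M, hM⟩ := (isCompact_closedBall z ε₂).exists_bound_of_continuousOn hfc
  obtain ⟨r₁, hr₁, ha₁⟩ := left_ae_near v C hC (fun r => Ioo (ξ₀ - r) ξ₀)
    (fun r s h => Ioo_subset_Ioo_left (by linarith)) z hL ε hεpos
  obtain ⟨r₂, hr₂, ha₂⟩ := left_ae_near v C hC (fun r => Ioo ξ₀ (ξ₀ + r))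
    (fun r s h => Ioo_subset_Ioo_right (by linarith)) z hR ε hεpos
  set r := min (min r₁ r₂) (κ / 2) with hr
  have hrpos : 0 < r := lt_min (lt_min hr₁ hr₂) (by linarith)
  have hrr₁ : r ≤ r₁ := (min_le_left _ _).trans (min_le_left _ _)
  have hrr₂ : r ≤ r₂ := (min_le_left _ _).trans (min_le_right _ _)
  have hrκ : r ≤ κ / 2 := min_le_right _ _
  have hne : ∀ᵐ x : ℝ, x ≠ ξ₀ := by simp [ae_iff, measure_singleton]
  set a := ξ₀ - r with ha
  set b := ξ₀ + r with hb
  have hab : a < b := by linarith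
  have hae : ∀ᵐ x : ℝ, x ∈ Ioo a b → v x ∈ Metric.ball z ε := by
    filter_upwards [ha₁, ha₂, hne] with x h1 h2 h3 hx
    rcases lt_or_gt_of_ne h3 with h | h
    · exact h1 ⟨by linarith [hx.1], h⟩
    · exact h2 ⟨h, by linarith [hx.2]⟩
  have hneb : ∀ᵐ x : ℝ, x ≠ b := by simp [ae_iff, measure_singleton]
  have hae' : ∀ᵐ x : ℝ ∂(volume.restrict (Ioc a b)), v x ∈ Metric.ball z ε := by
    rw [ae_restrict_iff' measurableSet_Ioc]
    filter_upwards [hae, hneb] with x hx hxb hxI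
    exact hx ⟨hxI.1, lt_of_le_of_ne hxI.2 hxb⟩
  have hvb : ∀ u ∈ Metric.ball z ε, ‖u‖ ≤ ‖z‖ + ε := by
    intro u hu
    have h1 : ‖u - z‖ < ε := by rwa [← dist_eq_norm]
    have h2 := norm_le_norm_add_norm_sub' u z
    linarith
  set Bv := ‖z‖ + ε with hBv
  have hBvpos : 0 < Bv := by positivity
  have hvi : ∀ i, IntervalIntegrable (fun x => v x i) volume a b := by
    intro i
    rw [intervalIntegrable_iff_integrableOn_Ioc_of_le hab.le]
    refine Measure.integrableOn_of_bounded (M := Bv) (by simp) ?_ ?_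
    · exact ((measurable_pi_apply i).comp hvm).aestronglyMeasurable
    · filter_upwards [hae'] with x hx
      exact (norm_le_pi_norm _ i).trans (hvb _ hx)
  have hfi : ∀ i, IntervalIntegrable (fun x => f (v x) i) volume a b := by
    intro i
    rw [intervalIntegrable_iff_integrableOn_Ioc_of_le hab.le]
    refine Integrable.of_bound (C := M) ?_ ?_
    · classical
      have hm : Measurable ((Metric.ball z ε).piecewise f 0) :=
        (hfc.mono hb2).measurable_piecewise continuousOn_const Metric.isOpen_ball.measurableSet
      have hm2 : Measurable (fun x => (Metric.ball z ε).piecewise f 0 (v x) i) :=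
        (measurable_pi_apply i).comp (hm.comp hvm)
      refine hm2.aestronglyMeasurable.congr ?_
      filter_upwards [hae'] with x hx
      simp only [piecewise_eq_of_mem _ _ _ hx]
    · filter_upwards [hae'] with x hx
      exact (norm_le_pi_norm _ i).trans (hM _ (hb2 hx))
  set g : ℝ → (Fin n → ℝ) := fun ξ => (-ξ) • v ξ + f (v ξ) with hg
  have hgi : ∀ i, IntervalIntegrable (fun x => g x i) volume a b := by
    intro i
    have h1 : IntervalIntegrable (fun x => (-x) * v x i) volume a b :=
      (hvi i).continuousOn_mul continuous_neg.continuousOn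
    exact h1.add (hfi i)
  have hdbr : ∀ i, ∃ c : ℝ, ∀ᵐ ξ : ℝ, ξ ∈ Ioo a b → g ξ i = c - ∫ t in a..ξ, v t i := by
    intro i
    refine dbr_aux a b hab _ _ (hgi i) (hvi i) ?_
    intro ψ h1 h2 h3
    have hΨd : ∀ x, HasDerivAt (fun ξ => (Pi.single i (ψ ξ) : Fin n → ℝ))
        (Pi.single i (deriv ψ x)) x := by
      intro x
      rw [hasDerivAt_pi]
      intro j
      by_cases hj : j = i
      · subst hj
        simpa using (h1.differentiable one_ne_zero x).hasDerivAt
      · simpa [hj] using hasDerivAt_const x (0:ℝ)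
    have hΨs : ContDiff ℝ 1 (fun ξ => (Pi.single i (ψ ξ) : Fin n → ℝ)) := by
      rw [contDiff_pi]
      intro j
      by_cases hj : j = i
      · subst hj
        simpa using h1
      · simpa [hj] using (contDiff_const (c := (0:ℝ)))
    have hΨc : HasCompactSupport (fun ξ => (Pi.single i (ψ ξ) : Fin n → ℝ)) :=
      h2.comp_left (g := fun y => (Pi.single i y : Fin n → ℝ)) (by simp)
    have hs := hsol _ hΨs hΨc
    rw [intervalIntegral.integral_eq_integral_of_support_subset, ← hs]
    · congr 1
      ext x
      rw [(hΨd x).deriv, single_dotProduct, single_dotProduct]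
    · intro x hx
      by_contra hcon
      have hxt : x ∉ tsupport ψ := fun h => hcon (Ioo_subset_Ioc_self (h3 h))
      have e1 : ψ x = 0 := image_eq_zero_of_notMem_tsupport hxt
      have e2 : deriv ψ x = 0 :=
        image_eq_zero_of_notMem_tsupport (fun h => hxt (tsupport_deriv_subset h))
      exact hx (by simp [e1, e2])
  choose c hc using hdbr
  have hcall : ∀ᵐ ξ : ℝ, ∀ i, ξ ∈ Ioo a b → g ξ i = c i - ∫ t in a..ξ, v t i := ae_all_iff.2 hc
  set T : Set ℝ := {x | x ∈ Ioo a b ∧ v x ∈ Metric.ball z ε ∧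
    ∀ i, g x i = c i - ∫ t in a..x, v t i} with hT
  have hTlip : LipschitzOnWith (Real.toNNReal (4 * Bv / κ)) v T := by
    refine LipschitzOnWith.of_dist_le_mul ?_
    intro x hx y hy
    rw [Real.coe_toNNReal _ (by positivity), dist_eq_norm, Real.dist_eq]
    have hI : ‖g x - g y‖ ≤ Bv * |x - y| := by
      rw [pi_norm_le_iff_of_nonneg (by positivity)]
      intro i
      have ax : IntervalIntegrable (fun t => v t i) volume a x :=
        (hvi i).mono_set (by
          rw [uIcc_of_le hx.1.1.le, uIcc_of_le hab.le]; exact Icc_subset_Icc_right hx.1.2.le)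
      have ay : IntervalIntegrable (fun t => v t i) volume a y :=
        (hvi i).mono_set (by
          rw [uIcc_of_le hy.1.1.le, uIcc_of_le hab.le]; exact Icc_subset_Icc_right hy.1.2.le)
      have e : (g x - g y) i = ∫ t in x..y, v t i := by
        rw [Pi.sub_apply, hx.2.2 i, hy.2.2 i,
          ← intervalIntegral.integral_interval_sub_left ay ax]
        ring
      rw [e, abs_sub_comm]
      refine intervalIntegral.norm_integral_le_of_norm_le_const_ae ?_
      filter_upwards [hae] with t ht htm
      refine (norm_le_pi_norm _ i).trans (hvb _ (ht ?_))
      have h1 : min x y < t := htm.1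
      have h2 : t ≤ max x y := htm.2
      exact ⟨(lt_min hx.1.1 hy.1.1).trans h1, h2.trans_lt (max_lt hx.1.2 hy.1.2)⟩
    have hl := hlow _ (hb1 hx.2.1) _ (hb1 hy.2.1)
    have e : f (v x) - f (v y) - ξ₀ • (v x - v y) =
        (g x - g y) + (x - ξ₀) • (v x - v y) + (x - y) • v y := by
      simp only [hg]
      module
    have hxr : |x - ξ₀| ≤ κ / 2 := by
      rw [abs_le]
      constructor <;> linarith [hx.1.1, hx.1.2]
    have h1 : ‖f (v x) - f (v y) - ξ₀ • (v x - v y)‖ ≤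
        Bv * |x - y| + κ / 2 * ‖v x - v y‖ + |x - y| * Bv := by
      rw [e]
      refine (norm_add₃_le).trans ?_
      rw [norm_smul, norm_smul, Real.norm_eq_abs, Real.norm_eq_abs]
      have := hvb _ hy.2.1
      gcongr
    rw [div_mul_eq_mul_div, le_div_iff₀ hκ]
    linarith
  obtain ⟨w, hw, hvw⟩ := hTlip.extend_pi
  refine ⟨w, hw.continuous, r, hrpos, ?_⟩
  filter_upwards [hae, hcall] with x h1 h2 hx
  exact hvw ⟨hx, h1 hx, fun i => h2 i hx⟩

theorem C_open_aux
    {n : ℕ} (U : Set (Fin n → ℝ)) (hU : IsOpen U)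
    (f : (Fin n → ℝ) → (Fin n → ℝ)) (hf : ContDiffOn ℝ 2 f U)
    (v : ℝ → (Fin n → ℝ)) (hv : IsReducedState f U v)
    (hsol : IsSSWeakSol f v) :
    IsOpen {ξ : ℝ | ∃ z : Fin n → ℝ, AessL v ξ = {z} ∧ AessR v ξ = {z} ∧
        detShift f ξ z ≠ 0} := by
  rw [isOpen_iff_mem_nhds]
  rintro ξ₀ ⟨z, hL, hR, hd⟩
  obtain ⟨hvm, ⟨C, hC⟩, hess⟩ := hv
  have hzU : z ∈ U := by
    refine (hess ?_).1
    have hz : z ∈ AessL v ξ₀ := by rw [hL]; rfl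
    simp only [AessL, mem_iInter] at hz
    intro V hV hzV
    exact (hz 1 one_pos V hV hzV).trans_le (measure_mono (inter_subset_inter_right _
      (subset_univ _)))
  obtain ⟨w, hw, r, hr, hvw⟩ := local_cont f U hU hf v hvm C hC hsol ξ₀ z hzU hL hR hd
  have hwz : w ξ₀ = z := by
    have := (accL_eq v w hw _ _ hvw ξ₀ ⟨by linarith, by linarith⟩).1
    rw [hL] at this
    exact (singleton_eq_singleton_iff.1 this).symm
  have hcont : ContinuousAt (fun ξ => detShift f ξ (w ξ)) ξ₀ := by
    have h1 : ContinuousAt (fderiv ℝ f) (w ξ₀) := by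
      rw [hwz]
      exact (hf.continuousOn_fderiv_of_isOpen hU (by norm_num)).continuousAt (hU.mem_nhds hzU)
    have h2 : ContinuousAt (fun ξ => fderiv ℝ f (w ξ)) ξ₀ := h1.comp hw.continuousAt
    have h3 : ContinuousAt (fun ξ : ℝ =>
        -(ξ • (ContinuousLinearMap.id ℝ (Fin n → ℝ))) + fderiv ℝ f (w ξ)) ξ₀ :=
      ((continuousAt_id.smul continuousAt_const).neg).add h2
    exact (ContinuousLinearMap.continuous_det.continuousAt).comp h3
  have hne : ∀ᶠ ξ in 𝓝 ξ₀, detShift f ξ (w ξ) ≠ 0 :=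
    hcont.eventually_ne (by simpa only [hwz] using hd)
  have hI : Ioo (ξ₀ - r) (ξ₀ + r) ∈ 𝓝 ξ₀ := Ioo_mem_nhds (by linarith) (by linarith)
  filter_upwards [hne, hI] with ξ h1 h2
  obtain ⟨hl, hr'⟩ := accL_eq v w hw _ _ hvw ξ h2
  exact ⟨w ξ, hl, hr', h1⟩

/-- For a self-similar weak solution, the union of the set `S` of
ess-im discontinuity points and the set `W` of resonant ess-im continuity points is
closed, and the set `C` of non-resonant ess-im continuity points is open. -/
theorem S_union_W_closed_and_C_open
    {n : ℕ} (U : Set (Fin n → ℝ)) (hU : IsOpen U)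
    (f : (Fin n → ℝ) → (Fin n → ℝ)) (hf : ContDiffOn ℝ 2 f U)
    (hconv : convexHull ℝ (USH f U) ⊆ U)
    (v : ℝ → (Fin n → ℝ)) (hv : IsReducedState f U v)
    (hsol : IsSSWeakSol f v) :
    IsClosed ({ξ : ℝ | ¬ EssImContPt v ξ} ∪
        {ξ : ℝ | ∃ z : Fin n → ℝ, AessL v ξ = {z} ∧ AessR v ξ = {z} ∧
          detShift f ξ z = 0}) ∧
      IsOpen {ξ : ℝ | ∃ z : Fin n → ℝ, AessL v ξ = {z} ∧ AessR v ξ = {z} ∧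
        detShift f ξ z ≠ 0} := by
  have hopen := C_open_aux U hU f hf v hv hsol
  refine ⟨?_, hopen⟩
  rw [← isOpen_compl_iff]
  convert hopen using 1
  ext ξ
  simp only [mem_compl_iff, mem_union, mem_setOf_eq, not_or, not_not]
  constructor
  · rintro ⟨⟨z, hl, hr⟩, h⟩
    exact ⟨z, hl, hr, fun h0 => h ⟨z, hl, hr, h0⟩⟩
  · rintro ⟨z, hl, hr, h⟩
    refine ⟨⟨z, hl, hr⟩, ?_⟩
    rintro ⟨z', hl', hr', h'⟩
    rw [hl] at hl'
    obtain rfl := singleton_eq_singleton_iff.1 hl'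
    exact h h'

end
end
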